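/- Let u : ℝ×ℝ → ℝ be a smooth classical solution of the mKdV equation u_t + (u_{xx} + u³)_x = 0 such that for each t, u(t,·) together with its x-derivatives up to order four is Schwartz (rapidly decaying). Then the quantity F[u](t) := (1/2)∫ u_{xx}(t,x)² dx − (5/2)∫ u(t,x)²·u_x(t,x)² dx + (1/4)∫ u(t,x)⁶ dx is conserved: for all t₁, t₂ ∈ ℝ, F[u](t₁) = F[u](t₂). -/

import Mathlib

open Real MeasureTheory

section

open Set Filter Topology

/-- If `S` is locally bounded on `Ioc a b`, `E` is constant on every interval on which `S` is
bounded, and the value of `E` controls the growth of `S`, then `E b = E a`. -/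
theorem eq_of_locallyBounded_Ioc {X : Type*} {S : ℝ → ℝ} {E : ℝ → X}
    (hcons : ∀ a b K, a ≤ b → (∀ t ∈ Icc a b, S t ≤ K) → E a = E b)
    (hcoer : ∀ M, ∃ K, ∀ s t, S s ≤ M → E t = E s → S t ≤ K)
    {a b : ℝ} (hab : a ≤ b) (hloc : ∀ t ∈ Ioc a b, ∃ K, ∀ᶠ s in 𝓝 t, S s ≤ K) :
    E b = E a := by
  have hE : ∀ s ∈ Ioc a b, E s = E b := by
    intro s hs
    have hbdd : ∃ K, ∀ t ∈ Icc s b, S t ≤ K := by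
      refine isCompact_Icc.induction_on (p := fun Z => ∃ K, ∀ t ∈ Z, S t ≤ K) ⟨0, by simp⟩
        (fun Z W hZW ⟨K, hK⟩ => ⟨K, fun t ht => hK t (hZW ht)⟩) ?_ ?_
      · rintro Z W ⟨K, hK⟩ ⟨L, hL⟩
        refine ⟨max K L, ?_⟩
        rintro t (ht | ht)
        · exact (hK t ht).trans (le_max_left _ _)
        · exact (hL t ht).trans (le_max_right _ _)
      · intro t ht
        obtain ⟨K, hK⟩ := hloc t ⟨hs.1.trans_le ht.1, ht.2⟩
        exact ⟨_, mem_nhdsWithin_of_mem_nhds hK, K, fun s hs => hs⟩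
    obtain ⟨K, hK⟩ := hbdd
    exact hcons s b K hs.2 hK
  obtain ⟨K, hK⟩ := hcoer (S b)
  refine (hcons a b (max K (S a)) hab fun t ht => ?_).symm
  rcases eq_or_lt_of_le ht.1 with rfl | h
  · exact le_max_right _ _
  · exact (hK b t le_rfl (hE t ⟨h, ht.2⟩)).trans (le_max_left _ _)

/-- One-sided propagation of a bound from a closed set across its complementary intervals. -/
theorem le_of_bounded_on_closed {X : Type*} {S : ℝ → ℝ} {E : ℝ → X}
    (hcons : ∀ a b K, a ≤ b → (∀ t ∈ Icc a b, S t ≤ K) → E a = E b)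
    (hcoer : ∀ M, ∃ K, ∀ s t, S s ≤ M → E t = E s → S t ≤ K)
    {B : Set ℝ} (hB : IsClosed B) (hloc : ∀ t ∉ B, ∃ K, ∀ᶠ s in 𝓝 t, S s ≤ K)
    {t₀ t M K : ℝ} (ht₀ : t₀ ∈ B) (htt : t₀ ≤ t) (hM : ∀ s ∈ Icc t₀ t, s ∈ B → S s ≤ M)
    (hK : ∀ s t, S s ≤ M → E t = E s → S t ≤ K) : S t ≤ K := by
  have hcomp : IsCompact (B ∩ Icc t₀ t) := isCompact_Icc.inter_left hB
  have hne : (B ∩ Icc t₀ t).Nonempty := ⟨t₀, ht₀, le_rfl, htt⟩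
  have ha := hcomp.sSup_mem hne
  refine hK _ t (hM _ ha.2 ha.1) (eq_of_locallyBounded_Ioc hcons hcoer ha.2.2 fun s hs => ?_)
  refine hloc s fun hsB => hs.1.not_ge ?_
  exact le_csSup hcomp.bddAbove ⟨hsB, ha.2.1.trans hs.1.le, hs.2⟩

/-- Baire category principle: if the invariant `E` is constant on every interval on which the
finite function `S` is bounded, `E` controls `S`, and `S` has closed sublevel sets, then `E` is
constant. -/
theorem constant_of_closed_sublevel {X : Type*} {S : ℝ → ℝ} {E : ℝ → X}
    (hclosed : ∀ K, IsClosed {t | S t ≤ K})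
    (hcons : ∀ a b K, a ≤ b → (∀ t ∈ Icc a b, S t ≤ K) → E a = E b)
    (hcoer : ∀ M, ∃ K, ∀ s t, S s ≤ M → E t = E s → S t ≤ K) (a b : ℝ) : E a = E b := by
  set G : Set ℝ := {t | ∃ K, ∀ᶠ s in 𝓝 t, S s ≤ K} with hG
  have hGo : IsOpen G := by
    rw [isOpen_iff_mem_nhds]
    rintro t ⟨K, hK⟩
    exact hK.eventually_nhds.mono fun s hs => ⟨K, hs⟩
  have hGuniv : G = univ := by
    by_contra hne
    set B := Gᶜ with hB
    have hBc : IsClosed B := hGo.isClosed_compl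
    have hBne : B.Nonempty := nonempty_compl.2 hne
    have : Nonempty B := hBne.to_subtype
    have : CompleteSpace B := hBc.completeSpace_coe
    obtain ⟨n, ⟨t₀, ht₀B⟩, ht₀⟩ := nonempty_interior_of_iUnion_of_closed
      (f := fun n : ℕ => {t : B | S t ≤ n})
      (fun n => (hclosed n).preimage continuous_subtype_val)
      (eq_univ_of_forall fun t => mem_iUnion.2 (exists_nat_ge (S t)))
    rw [mem_interior_iff_mem_nhds, nhds_subtype_eq_comap, Filter.mem_comap] at ht₀
    obtain ⟨V, hV, hVs⟩ := ht₀
    obtain ⟨r, hr, hrV⟩ := Metric.mem_nhds_iff.1 hV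
    have hSn : ∀ s ∈ Metric.ball t₀ r, s ∈ B → S s ≤ n := fun s hs hsB =>
      hVs (a := ⟨s, hsB⟩) (hrV hs)
    have hloc : ∀ t ∉ B, ∃ K, ∀ᶠ s in 𝓝 t, S s ≤ K := fun t ht => not_not.1 ht
    obtain ⟨K, hK⟩ := hcoer n
    refine ht₀B ⟨K, Filter.mem_of_superset (Metric.ball_mem_nhds t₀ hr) fun t ht => ?_⟩
    rw [Real.ball_eq_Ioo] at hSn ht
    rcases le_total t₀ t with h | h
    · exact le_of_bounded_on_closed hcons hcoer hBc hloc ht₀B h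
        (fun s hs => hSn s ⟨by linarith [hs.1], by linarith [hs.2, ht.2]⟩) hK
    · have := le_of_bounded_on_closed (S := fun s => S (-s)) (E := fun s => E (-s))
        (fun a b K hab hS => (hcons (-b) (-a) K (by linarith) fun t ht => by
          simpa using hS (-t) ⟨by linarith [ht.2], by linarith [ht.1]⟩).symm)
        (fun M => (hcoer M).imp fun K hK s t => hK (-s) (-t))
        (B := Neg.neg ⁻¹' B) (hBc.preimage continuous_neg)
        (fun t ht => (hloc (-t) ht).imp fun K hK => continuous_neg.continuousAt.eventually hK)
        (t₀ := -t₀) (t := -t) (M := n) (K := K) (by simpa using ht₀B) (by linarith)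
        (fun s hs => hSn (-s) ⟨by linarith [hs.2, ht.1], by linarith [hs.1]⟩)
        (fun s t => hK (-s) (-t))
      simpa using this
  have key : ∀ a b : ℝ, a ≤ b → E a = E b := fun a b hab =>
    (eq_of_locallyBounded_Ioc hcons hcoer hab fun t _ => (hGuniv ▸ mem_univ t : t ∈ G)).symm
  rcases le_total a b with h | h
  · exact key a b h
  · exact (key b a h).symm

/-- Bounded convergence: a limit of functions with uniformly bounded derivatives tending to zero
pointwise takes equal values at the endpoints. -/
theorem eq_of_tendsto_of_bounded_deriv {Q Q' : ℕ → ℝ → ℝ} {F : ℝ → ℝ} {a b C : ℝ} (hab : a ≤ b)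
    (hd : ∀ n t, HasDerivAt (Q n) (Q' n t) t)
    (hQ : ∀ t ∈ Icc a b, Tendsto (fun n => Q n t) atTop (𝓝 (F t)))
    (hC : ∀ n, ∀ t ∈ Icc a b, |Q' n t| ≤ C)
    (hQ' : ∀ t ∈ Icc a b, Tendsto (fun n => Q' n t) atTop (𝓝 0)) : F a = F b := by
  have hmeas : ∀ n, Measurable (Q' n) := fun n => by
    rw [show Q' n = deriv (Q n) from funext fun t => ((hd n t).deriv).symm]
    exact measurable_deriv _
  have hsub : uIoc a b ⊆ Icc a b := by
    rw [uIoc_of_le hab]; exact Ioc_subset_Icc_self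
  have h_int : ∀ n, IntervalIntegrable (Q' n) volume a b := fun n => by
    rw [intervalIntegrable_iff]
    refine Measure.integrableOn_of_bounded (M := C) (by simp) (hmeas n).aestronglyMeasurable ?_
    exact (ae_restrict_iff' measurableSet_uIoc).2 (ae_of_all _ fun t ht => hC n t (hsub ht))
  have h1 : Tendsto (fun n => ∫ t in a..b, Q' n t) atTop (𝓝 (∫ _ in a..b, (0 : ℝ))) := by
    refine intervalIntegral.tendsto_integral_filter_of_dominated_convergence (fun _ => C)
      (Eventually.of_forall fun n => (hmeas n).aestronglyMeasurable)
      (Eventually.of_forall fun n => ae_of_all _ fun t ht => hC n t (hsub ht))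
      intervalIntegrable_const (ae_of_all _ fun t ht => hQ' t (hsub ht))
  have h2 : ∀ n, ∫ t in a..b, Q' n t = Q n b - Q n a := fun n =>
    intervalIntegral.integral_eq_sub_of_hasDerivAt (fun t _ => hd n t) (h_int n)
  simp only [h2, intervalIntegral.integral_zero] at h1
  have h3 := (hQ b ⟨hab, le_rfl⟩).sub (hQ a ⟨le_rfl, hab⟩)
  linarith [tendsto_nhds_unique h1 h3]

theorem integrable_of_abs_le_inv_one_add_sq {g : ℝ → ℝ} (hg : Continuous g) {C : ℝ}
    (hC : ∀ x, |g x| ≤ C * (1 + x ^ 2)⁻¹) : Integrable g :=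
  (integrable_inv_one_add_sq.const_mul C).mono' hg.aestronglyMeasurable (ae_of_all _ hC)

theorem tendsto_integral_zero_of_abs_le_inv_one_add_sq {I : ℕ → ℝ → ℝ}
    (hI : ∀ n, Continuous (I n)) {C : ℝ} (hC : ∀ n x, |I n x| ≤ C * (1 + x ^ 2)⁻¹)
    (h0 : ∀ x, Tendsto (fun n => I n x) atTop (𝓝 0)) :
    Tendsto (fun n => ∫ x, I n x) atTop (𝓝 0) := by
  simpa using tendsto_integral_of_dominated_convergence (fun x : ℝ => C * (1 + x ^ 2)⁻¹)
    (fun n => (hI n).aestronglyMeasurable) (integrable_inv_one_add_sq.const_mul C)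
    (fun n => ae_of_all _ (hC n)) (ae_of_all _ h0)

/-- Differentiation under the integral sign against a continuous compactly supported weight. -/
theorem hasDerivAt_integral_mul_hasCompactSupport {e e' : ℝ → ℝ → ℝ} {χ : ℝ → ℝ}
    (he : ∀ t, Continuous (e t)) (he' : Continuous (Function.uncurry e'))
    (hd : ∀ t x, HasDerivAt (fun s => e s x) (e' t x) t)
    (hχ : Continuous χ) (hχs : HasCompactSupport χ) (t : ℝ) :
    HasDerivAt (fun s => ∫ x, e s x * χ x) (∫ x, e' t x * χ x) t := by
  obtain ⟨C, hC⟩ := ((isCompact_closedBall t 1).prod hχs.isCompact).exists_bound_of_continuousOn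
    he'.continuousOn
  have he't : Continuous (e' t) := he'.comp (Continuous.prodMk_right t)
  refine (hasDerivAt_integral_of_dominated_loc_of_deriv_le (F := fun s x => e s x * χ x)
    (F' := fun s x => e' s x * χ x) (bound := fun x => C * |χ x|)
    (Metric.closedBall_mem_nhds t one_pos)
    (Eventually.of_forall fun s => ((he s).mul hχ).aestronglyMeasurable)
    (((he t).mul hχ).integrable_of_hasCompactSupport hχs.mul_left)
    (he't.mul hχ).aestronglyMeasurable (ae_of_all _ fun x s hs => ?_)
    ((hχ.integrable_of_hasCompactSupport hχs).abs.const_mul C)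
    (ae_of_all _ fun x s _ => (hd s x).mul_const _)).2
  by_cases hx : χ x = 0
  · simp [hx]
  · rw [norm_mul]
    exact mul_le_mul_of_nonneg_right (hC (s, x) ⟨hs, subset_tsupport _ hx⟩) (abs_nonneg _)

theorem integral_deriv_mul_add_mul_deriv_eq_zero {f f' χ χ' : ℝ → ℝ}
    (hf : ∀ x, HasDerivAt f (f' x) x) (hf' : Continuous f')
    (hχ : ∀ x, HasDerivAt χ (χ' x) x) (hχ' : Continuous χ')
    (hχs : HasCompactSupport χ) (hχs' : HasCompactSupport χ') :
    Integrable (fun x => f' x * χ x + f x * χ' x) ∧ ∫ x, (f' x * χ x + f x * χ' x) = 0 := by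
  have hfc : Continuous f := continuous_iff_continuousAt.2 fun x => (hf x).continuousAt
  have hχc : Continuous χ := continuous_iff_continuousAt.2 fun x => (hχ x).continuousAt
  have h1 : Integrable (fun x => f' x * χ x + f x * χ' x) :=
    ((hf'.mul hχc).integrable_of_hasCompactSupport hχs.mul_left).add
      ((hfc.mul hχ').integrable_of_hasCompactSupport hχs'.mul_left)
  exact ⟨h1, integral_eq_zero_of_hasDerivAt_of_integrable (fun x => (hf x).mul (hχ x)) h1
    ((hfc.mul hχc).integrable_of_hasCompactSupport hχs.mul_left)⟩

/-- A difference quotient is bounded in `L²` by the derivative. -/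
theorem integral_sq_differenceQuotient_le {f f' : ℝ → ℝ} (hf : ∀ x, HasDerivAt f (f' x) x)
    (hf' : Continuous f') (h_int : Integrable fun x => f' x ^ 2) {h k : ℝ} (hk : k * h = 1) :
    ∫ x, (k * (f (x + h) - f x)) ^ 2 ≤ ∫ x, f' x ^ 2 := by
  have hfc : Continuous f := continuous_iff_continuousAt.2 fun x => (hf x).continuousAt
  have hq : ∀ x, k * (f (x + h) - f x) = ∫ θ in (0 : ℝ)..1, f' (x + θ * h) := by
    intro x
    have h1 : ∀ θ : ℝ, HasDerivAt (fun θ => k * f (x + θ * h)) (f' (x + θ * h)) θ := by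
      intro θ
      have h2 : HasDerivAt (fun θ : ℝ => x + θ * h) h θ := by
        simpa using ((hasDerivAt_id θ).mul_const h).const_add x
      refine (((hf _).comp θ h2).const_mul k).congr_deriv ?_
      linear_combination f' (x + θ * h) * hk
    rw [intervalIntegral.integral_eq_sub_of_hasDerivAt (fun θ _ => h1 θ)
      (Continuous.intervalIntegrable (by fun_prop) _ _)]
    simp [mul_sub]
  have hjensen : ∀ x, (k * (f (x + h) - f x)) ^ 2
      ≤ ∫ θ in (0 : ℝ)..1, f' (x + θ * h) ^ 2 := by
    intro x
    set m := k * (f (x + h) - f x) with hm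
    have h1 : (0 : ℝ) ≤ ∫ θ in (0 : ℝ)..1, (f' (x + θ * h) - m) ^ 2 :=
      intervalIntegral.integral_nonneg zero_le_one fun θ _ => sq_nonneg _
    have h2 : ∫ θ in (0 : ℝ)..1, (f' (x + θ * h) - m) ^ 2
        = (∫ θ in (0 : ℝ)..1, f' (x + θ * h) ^ 2) - 2 * m * (∫ θ in (0 : ℝ)..1, f' (x + θ * h))
          + m ^ 2 := by
      have e : ∀ θ, (f' (x + θ * h) - m) ^ 2
          = (f' (x + θ * h) ^ 2 - 2 * m * f' (x + θ * h)) + m ^ 2 := fun θ => by ring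
      simp only [e]
      rw [intervalIntegral.integral_add (Continuous.intervalIntegrable (by fun_prop) _ _)
        (Continuous.intervalIntegrable (by fun_prop) _ _),
        intervalIntegral.integral_sub (Continuous.intervalIntegrable (by fun_prop) _ _)
        (Continuous.intervalIntegrable (by fun_prop) _ _)]
      simp
    rw [h2, ← hq x, ← hm] at h1
    nlinarith
  have hnn : 0 ≤ ∫ x, f' x ^ 2 := integral_nonneg fun x => sq_nonneg _
  rw [integral_eq_lintegral_of_nonneg_ae (ae_of_all _ fun x => sq_nonneg _)
    (Continuous.aestronglyMeasurable (by fun_prop))]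
  refine ENNReal.toReal_le_of_le_ofReal hnn ?_
  calc ∫⁻ x, ENNReal.ofReal ((k * (f (x + h) - f x)) ^ 2)
      ≤ ∫⁻ x, ∫⁻ θ in Ioc (0 : ℝ) 1, ENNReal.ofReal (f' (x + θ * h) ^ 2) := by
        refine lintegral_mono fun x => ?_
        refine (ENNReal.ofReal_le_ofReal (hjensen x)).trans ?_
        rw [intervalIntegral.integral_of_le zero_le_one, ofReal_integral_eq_lintegral_ofReal
          ((Continuous.integrableOn_Icc (by fun_prop)).mono_set Ioc_subset_Icc_self)
          (ae_of_all _ fun θ => sq_nonneg _)]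
    _ = ∫⁻ θ in Ioc (0 : ℝ) 1, ∫⁻ x, ENNReal.ofReal (f' (x + θ * h) ^ 2) := by
        refine lintegral_lintegral_swap (Measurable.aemeasurable ?_)
        refine (Continuous.measurable ?_).ennreal_ofReal
        fun_prop
    _ = ∫⁻ θ in Ioc (0 : ℝ) 1, ENNReal.ofReal (∫ x, f' x ^ 2) := by
        refine lintegral_congr fun θ => ?_
        rw [lintegral_add_right_eq_self (fun x => ENNReal.ofReal (f' x ^ 2)) (θ * h),
          ofReal_integral_eq_lintegral_ofReal h_int (ae_of_all _ fun θ => sq_nonneg _)]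
    _ = ENNReal.ofReal (∫ x, f' x ^ 2) := by simp

/-- Agmon's inequality for functions vanishing at infinity. -/
theorem sq_le_weighted_integral {f f' : ℝ → ℝ} (hf : ∀ x, HasDerivAt f (f' x) x)
    (hi : Integrable fun x => f x ^ 2) (hi' : Integrable fun x => f' x ^ 2)
    (hff' : Integrable fun x => f x * f' x)
    (h0 : Tendsto f atBot (𝓝 0)) {η : ℝ} (hη : 0 < η) (x : ℝ) :
    f x ^ 2 ≤ η⁻¹ * (∫ y, f y ^ 2) + η * ∫ y, f' y ^ 2 := by
  have hd : ∀ y, HasDerivAt (fun y => f y ^ 2) (2 * (f y * f' y)) y := fun y =>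
    ((hf y).pow 2).congr_deriv (by ring)
  have h1 := integral_Iic_of_hasDerivAt_of_tendsto (a := x) (hd x).continuousAt.continuousWithinAt
    (fun y _ => hd y) (hff'.const_mul 2).integrableOn (m := 0) (by simpa using h0.pow 2)
  have h_int : Integrable fun y => η⁻¹ * f y ^ 2 + η * f' y ^ 2 :=
    (hi.const_mul _).add (hi'.const_mul _)
  rw [← integral_const_mul, ← integral_const_mul,
    ← integral_add (hi.const_mul _) (hi'.const_mul _)]
  calc f x ^ 2 = ∫ y in Iic x, 2 * (f y * f' y) := by rw [h1]; ring
    _ ≤ ∫ y in Iic x, (η⁻¹ * f y ^ 2 + η * f' y ^ 2) := by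
        refine integral_mono (hff'.const_mul 2).integrableOn h_int.integrableOn fun y => ?_
        have : 0 ≤ η⁻¹ * (f y - η * f' y) ^ 2 := by positivity
        have e : η⁻¹ * (f y - η * f' y) ^ 2
            = η⁻¹ * f y ^ 2 + η * f' y ^ 2 - 2 * (f y * f' y) := by
          field_simp
          ring
        simp only
        linarith
    _ ≤ ∫ y, (η⁻¹ * f y ^ 2 + η * f' y ^ 2) :=
        setIntegral_le_integral h_int (ae_of_all _ fun y => by
          have := sq_nonneg (f y); have := sq_nonneg (f' y); simp only [Pi.zero_apply]; positivity)

/-- Continuous functions on the line bounded by a multiple of `(1 + x²)⁻¹`. -/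
structure HasInvSqDecay (f : ℝ → ℝ) : Prop where
  continuous : Continuous f
  bound : ∃ C, ∀ x, |f x| ≤ C * (1 + x ^ 2)⁻¹

namespace HasInvSqDecay

variable {f g : ℝ → ℝ}

theorem integrable (hf : HasInvSqDecay f) : Integrable f :=
  let ⟨_, hC⟩ := hf.bound
  integrable_of_abs_le_inv_one_add_sq hf.continuous hC

theorem mul (hf : HasInvSqDecay f) (hg : HasInvSqDecay g) :
    HasInvSqDecay fun x => f x * g x := by
  obtain ⟨C, hC⟩ := hf.bound
  obtain ⟨D, hD⟩ := hg.bound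
  refine ⟨hf.continuous.mul hg.continuous, C * D, fun x => ?_⟩
  have hw : (1 + x ^ 2)⁻¹ ≤ (1 : ℝ) := inv_le_one_of_one_le₀ (by nlinarith [sq_nonneg x])
  have hw0 : (0 : ℝ) < (1 + x ^ 2)⁻¹ := by positivity
  have hC0 : 0 ≤ C * (1 + x ^ 2)⁻¹ := (abs_nonneg _).trans (hC x)
  have hD0 : 0 ≤ D * (1 + x ^ 2)⁻¹ := (abs_nonneg _).trans (hD x)
  have hD1 : D * (1 + x ^ 2)⁻¹ ≤ D :=
    mul_le_of_le_one_right (nonneg_of_mul_nonneg_left hD0 hw0) hw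
  rw [abs_mul]
  calc |f x| * |g x| ≤ (C * (1 + x ^ 2)⁻¹) * D :=
        mul_le_mul (hC x) ((hD x).trans hD1) (abs_nonneg _) hC0
    _ = C * D * (1 + x ^ 2)⁻¹ := by ring

theorem pow (hf : HasInvSqDecay f) {n : ℕ} (hn : n ≠ 0) : HasInvSqDecay fun x => f x ^ n := by
  obtain ⟨m, rfl⟩ := Nat.exists_eq_succ_of_ne_zero hn
  clear hn
  induction m with
  | zero => simpa using hf
  | succ m ih => simpa only [Nat.succ_eq_add_one, pow_succ _ (m + 1)] using ih.mul hf

theorem tendsto_atBot (hf : HasInvSqDecay f) : Tendsto f atBot (𝓝 0) := by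
  obtain ⟨C, hC⟩ := hf.bound
  refine squeeze_zero_norm hC ?_
  have h : Tendsto (fun x : ℝ => 1 + x ^ 2) atBot atTop := by
    refine tendsto_atTop_add_const_left atBot (1 : ℝ) ?_
    simpa [Function.comp_def, sq_abs] using
      (tendsto_pow_atTop (α := ℝ) two_ne_zero).comp tendsto_abs_atBot_atTop
  simpa using (tendsto_inv_atTop_zero.comp h).const_mul C

end HasInvSqDecay

/-- A function with decaying first two derivatives. -/
structure IsDecayingJet (a₀ a₁ a₂ : ℝ → ℝ) : Prop where
  hasDerivAt₀ : ∀ x, HasDerivAt a₀ (a₁ x) x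
  hasDerivAt₁ : ∀ x, HasDerivAt a₁ (a₂ x) x
  decay₀ : HasInvSqDecay a₀
  decay₁ : HasInvSqDecay a₁
  decay₂ : HasInvSqDecay a₂

/-- The squared `H²` norm of a jet. -/
noncomputable def sobolevSq (a₀ a₁ a₂ : ℝ → ℝ) : ℝ := ∫ x, (a₀ x ^ 2 + a₁ x ^ 2 + a₂ x ^ 2)

/-- The second mKdV energy of a jet. -/
noncomputable def mkdvEnergy (a₀ a₁ a₂ : ℝ → ℝ) : ℝ :=
  (1 / 2) * (∫ x, a₂ x ^ 2) - (5 / 2) * (∫ x, a₀ x ^ 2 * a₁ x ^ 2) + (1 / 4) * ∫ x, a₀ x ^ 6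

namespace IsDecayingJet

variable {a₀ a₁ a₂ : ℝ → ℝ}

theorem sobolevSq_eq (h : IsDecayingJet a₀ a₁ a₂) :
    sobolevSq a₀ a₁ a₂ = (∫ x, a₀ x ^ 2) + (∫ x, a₁ x ^ 2) + ∫ x, a₂ x ^ 2 := by
  have h01 : Integrable fun x => a₀ x ^ 2 + a₁ x ^ 2 :=
    (h.decay₀.pow two_ne_zero).integrable.add (h.decay₁.pow two_ne_zero).integrable
  rw [sobolevSq, integral_add h01 (h.decay₂.pow two_ne_zero).integrable,
    integral_add (h.decay₀.pow two_ne_zero).integrable (h.decay₁.pow two_ne_zero).integrable]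

theorem sq_le₀ (h : IsDecayingJet a₀ a₁ a₂) {η : ℝ} (hη : 0 < η) (x : ℝ) :
    a₀ x ^ 2 ≤ η⁻¹ * (∫ y, a₀ y ^ 2) + η * ∫ y, a₁ y ^ 2 :=
  sq_le_weighted_integral h.hasDerivAt₀ (h.decay₀.pow two_ne_zero).integrable
    (h.decay₁.pow two_ne_zero).integrable
    (h.decay₀.mul h.decay₁).integrable h.decay₀.tendsto_atBot hη x

theorem sq_le_sobolevSq₀ (h : IsDecayingJet a₀ a₁ a₂) (x : ℝ) :
    a₀ x ^ 2 ≤ sobolevSq a₀ a₁ a₂ := by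
  have h1 := h.sq_le₀ one_pos x
  have h2 : 0 ≤ ∫ x, a₂ x ^ 2 := integral_nonneg fun x => sq_nonneg _
  rw [h.sobolevSq_eq]
  linarith

theorem sq_le_sobolevSq₁ (h : IsDecayingJet a₀ a₁ a₂) (x : ℝ) :
    a₁ x ^ 2 ≤ sobolevSq a₀ a₁ a₂ := by
  have h1 := sq_le_weighted_integral h.hasDerivAt₁ (h.decay₁.pow two_ne_zero).integrable
    (h.decay₂.pow two_ne_zero).integrable (h.decay₁.mul h.decay₂).integrable
    h.decay₁.tendsto_atBot one_pos x
  have h2 : 0 ≤ ∫ x, a₀ x ^ 2 := integral_nonneg fun x => sq_nonneg _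
  rw [h.sobolevSq_eq]
  linarith

theorem mkdvEnergy_le (h : IsDecayingJet a₀ a₁ a₂) {M : ℝ} (hM : sobolevSq a₀ a₁ a₂ ≤ M) :
    mkdvEnergy a₀ a₁ a₂ ≤ M / 2 + M ^ 3 / 4 := by
  have hS := h.sobolevSq_eq
  have h0 : 0 ≤ ∫ x, a₀ x ^ 2 := integral_nonneg fun x => sq_nonneg _
  have h1 : 0 ≤ ∫ x, a₁ x ^ 2 := integral_nonneg fun x => sq_nonneg _
  have h2 : 0 ≤ ∫ x, a₂ x ^ 2 := integral_nonneg fun x => sq_nonneg _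
  have h3 : 0 ≤ ∫ x, a₀ x ^ 2 * a₁ x ^ 2 := integral_nonneg fun x => by positivity
  have h4 : ∫ x, a₀ x ^ 6 ≤ M ^ 2 * ∫ x, a₀ x ^ 2 := by
    rw [← integral_const_mul]
    refine integral_mono (h.decay₀.pow (n := 6) (by norm_num)).integrable ((h.decay₀.pow two_ne_zero).integrable.const_mul _)
      fun x => ?_
    have h5 := (h.sq_le_sobolevSq₀ x).trans hM
    have h6 : (a₀ x ^ 2) ^ 2 ≤ M ^ 2 := pow_le_pow_left₀ (sq_nonneg _) h5 2
    simp only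
    nlinarith [sq_nonneg (a₀ x)]
  have h5 : M ^ 2 * ∫ x, a₀ x ^ 2 ≤ M ^ 2 * M :=
    mul_le_mul_of_nonneg_left (by linarith) (sq_nonneg M)
  rw [mkdvEnergy]
  nlinarith

/-- The mass and the second energy control the `H²` norm. -/
theorem sobolevSq_le (h : IsDecayingJet a₀ a₁ a₂) {M : ℝ} (hA : ∫ x, a₀ x ^ 2 ≤ M)
    (hE : mkdvEnergy a₀ a₁ a₂ ≤ M) :
    sobolevSq a₀ a₁ a₂ ≤ 2 * (M + (4 * M + 8 * (50 * (M + 1) * M) ^ 2 * (M + 1))) := by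
  have hi0 := (h.decay₀.pow two_ne_zero).integrable
  have hi1 := (h.decay₁.pow two_ne_zero).integrable
  have hi2 := (h.decay₂.pow two_ne_zero).integrable
  have h02 := (h.decay₀.mul h.decay₂).integrable
  have hB : ∫ x, a₁ x ^ 2 = -∫ x, a₀ x * a₂ x := by
    have := integral_mul_deriv_eq_deriv_mul_of_integrable (u := a₀) (v := a₁)
      (fun x _ => h.hasDerivAt₀ x) (fun x _ => h.hasDerivAt₁ x) h02
      (h.decay₁.mul h.decay₁).integrable (h.decay₀.mul h.decay₁).integrable
    rw [this, neg_neg]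
    simp only [sq]
  have hP : ∀ η : ℝ, 0 < η → ∫ x, a₀ x ^ 2 * a₁ x ^ 2
      ≤ (η⁻¹ * (∫ x, a₀ x ^ 2) + η * ∫ x, a₁ x ^ 2) * ∫ x, a₁ x ^ 2 := by
    intro η hη
    rw [← integral_const_mul (_ + _)]
    refine integral_mono ((h.decay₀.pow two_ne_zero).mul (h.decay₁.pow two_ne_zero)).integrable (hi1.const_mul _)
      fun x => ?_
    exact mul_le_mul_of_nonneg_right (h.sq_le₀ hη x) (sq_nonneg _)
  have hCS : ∀ s : ℝ, 0 ≤ (∫ x, a₀ x ^ 2) * (s * s) + (-2 * ∫ x, a₁ x ^ 2) * s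
      + ∫ x, a₂ x ^ 2 := by
    intro s
    have h1 : 0 ≤ ∫ x, (s * a₀ x + a₂ x) ^ 2 := integral_nonneg fun x => sq_nonneg _
    have h2 : ∫ x, (s * a₀ x + a₂ x) ^ 2 = s ^ 2 * (∫ x, a₀ x ^ 2)
        + 2 * s * (∫ x, a₀ x * a₂ x) + ∫ x, a₂ x ^ 2 := by
      have e : ∀ x, (s * a₀ x + a₂ x) ^ 2
          = (s ^ 2 * a₀ x ^ 2 + 2 * s * (a₀ x * a₂ x)) + a₂ x ^ 2 := fun x => by ring
      have hi : Integrable fun x => s ^ 2 * a₀ x ^ 2 + 2 * s * (a₀ x * a₂ x) :=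
        (hi0.const_mul _).add (h02.const_mul _)
      simp only [e]
      rw [integral_add hi hi2,
        integral_add (hi0.const_mul _) (h02.const_mul _), integral_const_mul, integral_const_mul]
    rw [hB]
    linarith
  have hdisc := discrim_le_zero hCS
  have hQ : 0 ≤ ∫ x, a₀ x ^ 6 := integral_nonneg fun x => by positivity
  have h0 : 0 ≤ ∫ x, a₀ x ^ 2 := integral_nonneg fun x => sq_nonneg _
  have h1 : 0 ≤ ∫ x, a₁ x ^ 2 := integral_nonneg fun x => sq_nonneg _
  have h2 : 0 ≤ ∫ x, a₂ x ^ 2 := integral_nonneg fun x => sq_nonneg _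
  rw [h.sobolevSq_eq]
  rw [mkdvEnergy] at hE
  rw [discrim] at hdisc
  clear hCS hB
  have hM : 0 ≤ M := h0.trans hA
  have hP' := hP (20 * (M + 1))⁻¹ (by positivity)
  generalize (∫ x, a₀ x ^ 2 * a₁ x ^ 2) = P at *
  generalize (∫ x, a₀ x ^ 6) = Q at *
  generalize (∫ x, a₀ x ^ 2) = A at *
  generalize (∫ x, a₁ x ^ 2) = B at *
  generalize (∫ x, a₂ x ^ 2) = D at *
  set k := 50 * (M + 1) * M with hk
  have hBD : B ^ 2 ≤ (M + 1) * D := by nlinarith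
  have hη : (20 * (M + 1))⁻¹ * B ^ 2 ≤ D / 20 := by
    rw [inv_mul_le_iff₀ (by positivity)]
    linarith
  have hAB : A * B ≤ M * B := mul_le_mul_of_nonneg_right hA h1
  have hkB : k * B ≤ 2 * k ^ 2 * (M + 1) + D / 8 := by
    have h3 : 0 ≤ (B - 4 * k * (M + 1)) ^ 2 := sq_nonneg _
    have h4 : (M + 1) * (k * B) ≤ (M + 1) * (2 * k ^ 2 * (M + 1) + D / 8) := by nlinarith
    exact le_of_mul_le_mul_left h4 (by positivity)
  have hP2 : 5 / 2 * P ≤ k * B + D / 8 := by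
    rw [inv_inv] at hP'
    nlinarith
  have hD : D ≤ 4 * M + 8 * k ^ 2 * (M + 1) := by linarith
  have hBle : B ≤ A + D := by nlinarith
  linarith

end IsDecayingJet

/-- Smooth cutoffs at spatial scale `(n + 1) ^ 3`, together with all their derivatives. -/
theorem exists_cutoff_sequence : ∃ (X : ℕ → ℕ → ℝ → ℝ) (B : ℝ), 0 ≤ B ∧
    (∀ n k x, HasDerivAt (X n k) (X n (k + 1) x) x) ∧ (∀ n k, HasCompactSupport (X n k)) ∧
    (∀ x, Tendsto (fun n => X n 0 x) atTop (𝓝 1)) ∧ (∀ n x, |X n 0 x| ≤ B) ∧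
    ∀ n, ∀ k ∈ Icc 1 3, ∀ x, |X n k x| ≤ B * (((n : ℝ) + 1) ^ 3)⁻¹ := by
  let b : ContDiffBump (0 : ℝ) := ⟨1, 2, one_pos, one_lt_two⟩
  set c : ℕ → ℝ → ℝ := fun k => iteratedDeriv k b with hc
  have hsm : ContDiff ℝ (⊤ : ℕ∞) b := b.contDiff
  have hcd : ∀ k x, HasDerivAt (c k) (c (k + 1) x) x := fun k x => by
    simp only [hc, iteratedDeriv_succ]
    exact ((hsm.differentiable_iteratedDeriv k (by exact_mod_cast WithTop.coe_lt_top k)) x).hasDerivAt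
  have hcc : ∀ k, Continuous (c k) := fun k =>
    continuous_iff_continuousAt.2 fun x => (hcd k x).continuousAt
  have hcs : ∀ k, HasCompactSupport (c k) := fun k => by
    induction k with
    | zero => simpa [hc] using b.hasCompactSupport
    | succ k ih => simpa only [hc, iteratedDeriv_succ] using ih.deriv
  choose D hD using fun k => (hcs k).exists_bound_of_continuous (hcc k)
  have hD0 : ∀ k, 0 ≤ D k := fun k => (norm_nonneg _).trans (hD k 0)
  set B := D 0 + D 1 + D 2 + D 3 with hB
  have hDB : ∀ k ≤ 3, D k ≤ B := fun k hk => by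
    have := hD0 0; have := hD0 1; have := hD0 2; have := hD0 3
    interval_cases k <;> linarith
  set r : ℕ → ℝ := fun n => (((n : ℝ) + 1) ^ 3)⁻¹ with hr
  have hr0 : ∀ n, 0 < r n := fun n => by positivity
  have hr1 : ∀ n, r n ≤ 1 := fun n =>
    inv_le_one_of_one_le₀ (one_le_pow₀ (by linarith [n.cast_nonneg (α := ℝ)]))
  refine ⟨fun n k x => r n ^ k * c k (r n * x), B, (hD0 0).trans (hDB 0 (by norm_num)),
    fun n k x => ?_, fun n k => ?_, fun x => ?_, fun n x => ?_, fun n k hk x => ?_⟩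
  · have h1 : HasDerivAt (fun x => r n * x) (r n) x := by
      simpa using (hasDerivAt_id x).const_mul (r n)
    refine (((hcd k _).comp x h1).const_mul (r n ^ k)).congr_deriv ?_
    dsimp only
    ring
  · have h1 : HasCompactSupport (fun x => c k (r n * x)) := by
      simpa using (hcs k).comp_smul (hr0 n).ne'
    exact h1.mul_left
  · have h1 : Tendsto r atTop (𝓝 0) := by
      have h2 : Tendsto (fun n : ℕ => (n : ℝ) + 1) atTop atTop :=
        tendsto_natCast_atTop_atTop.atTop_add tendsto_const_nhds
      exact tendsto_inv_atTop_zero.comp ((tendsto_pow_atTop three_ne_zero).comp h2)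
    have h3 : Tendsto (fun n => c 0 (r n * x)) atTop (𝓝 (c 0 (0 * x))) :=
      ((hcc 0).tendsto _).comp (h1.mul_const x)
    have h4 : c 0 (0 * x) = 1 := by
      simpa [hc] using b.one_of_mem_closedBall (Metric.mem_closedBall_self b.rIn_pos.le)
    rw [h4] at h3
    simpa using h3
  · simpa using (hD 0 (r n * x)).trans (hDB 0 (by norm_num))
  · rw [abs_mul, abs_of_pos (pow_pos (hr0 n) k), mul_comm]
    refine mul_le_mul ((hD k _).trans (hDB k hk.2)) ?_ (pow_pos (hr0 n) k).le
      ((hD0 0).trans (hDB 0 (by norm_num)))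
    exact pow_le_of_le_one (hr0 n).le (hr1 n) (by have := hk.1; omega)

/-- A jet of functions `U k` modelling the `x`-derivatives of a solution of mKdV with decay. -/
structure IsMKdVJet (U : ℕ → ℝ → ℝ → ℝ) : Prop where
  hasDerivAt_space : ∀ k t x, HasDerivAt (U k t) (U (k + 1) t x) x
  continuous : ∀ k, Continuous (Function.uncurry (U k))
  hasDerivAt_time₀ : ∀ t x,
    HasDerivAt (fun s => U 0 s x) (-(U 3 t x + 3 * U 0 t x ^ 2 * U 1 t x)) t
  hasDerivAt_time₁ : ∀ t x, HasDerivAt (fun s => U 1 s x)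
    (-(U 4 t x + 3 * U 0 t x ^ 2 * U 2 t x + 6 * U 0 t x * U 1 t x ^ 2)) t
  jet : ∀ t, IsDecayingJet (U 0 t) (U 1 t) (U 2 t)

/-- Integration against a cutoff `χ` of a density whose derivative is a source plus a flux
involving up to two derivatives of the cutoff. -/
theorem integral_eq_of_flux {e I x₀ x₁ x₂ y₀ y₁ y₂ χ χ₁ χ₂ χ₃ : ℝ → ℝ}
    (he : Continuous e) (hy₀ : Continuous y₀) (hy₁ : Continuous y₁) (hy₂ : Continuous y₂)
    (hx₀ : ∀ x, HasDerivAt x₀ (y₀ x) x) (hx₁ : ∀ x, HasDerivAt x₁ (y₁ x) x)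
    (hx₂ : ∀ x, HasDerivAt x₂ (y₂ x) x)
    (hχ : ∀ x, HasDerivAt χ (χ₁ x) x) (hχ₁ : ∀ x, HasDerivAt χ₁ (χ₂ x) x)
    (hχ₂ : ∀ x, HasDerivAt χ₂ (χ₃ x) x) (hχ₃ : Continuous χ₃)
    (hs : HasCompactSupport χ) (hs₁ : HasCompactSupport χ₁) (hs₂ : HasCompactSupport χ₂)
    (hs₃ : HasCompactSupport χ₃)
    (heq : ∀ x, e x * χ x = I x + ((y₀ x * χ x + x₀ x * χ₁ x)
      + (y₁ x * χ₁ x + x₁ x * χ₂ x) + (y₂ x * χ₂ x + x₂ x * χ₃ x))) :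
    ∫ x, e x * χ x = ∫ x, I x := by
  have hχc : Continuous χ := continuous_iff_continuousAt.2 fun x => (hχ x).continuousAt
  have hχc₁ : Continuous χ₁ := continuous_iff_continuousAt.2 fun x => (hχ₁ x).continuousAt
  have hχc₂ : Continuous χ₂ := continuous_iff_continuousAt.2 fun x => (hχ₂ x).continuousAt
  obtain ⟨i₀, z₀⟩ := integral_deriv_mul_add_mul_deriv_eq_zero hx₀ hy₀ hχ hχc₁ hs hs₁
  obtain ⟨i₁, z₁⟩ := integral_deriv_mul_add_mul_deriv_eq_zero hx₁ hy₁ hχ₁ hχc₂ hs₁ hs₂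
  obtain ⟨i₂, z₂⟩ := integral_deriv_mul_add_mul_deriv_eq_zero hx₂ hy₂ hχ₂ hχ₃ hs₂ hs₃
  have hi : Integrable fun x => e x * χ x :=
    (he.mul hχc).integrable_of_hasCompactSupport hs.mul_left
  have i₀₁ : Integrable fun x => (y₀ x * χ x + x₀ x * χ₁ x) + (y₁ x * χ₁ x + x₁ x * χ₂ x) :=
    i₀.add i₁
  have i₀₁₂ : Integrable fun x => (y₀ x * χ x + x₀ x * χ₁ x)
      + (y₁ x * χ₁ x + x₁ x * χ₂ x) + (y₂ x * χ₂ x + x₂ x * χ₃ x) := i₀₁.add i₂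
  have hI : ∀ x, I x = e x * χ x - ((y₀ x * χ x + x₀ x * χ₁ x)
      + (y₁ x * χ₁ x + x₁ x * χ₂ x) + (y₂ x * χ₂ x + x₂ x * χ₃ x)) := fun x => by
    rw [heq x]; ring
  simp only [hI]
  rw [integral_sub hi i₀₁₂, integral_add i₀₁ i₂, integral_add i₀ i₁, z₀, z₁, z₂]
  ring

theorem one_add_sq_inv_le {x y : ℝ} (h : |y - x| ≤ 1) :
    (1 + y ^ 2)⁻¹ ≤ 3 * (1 + x ^ 2)⁻¹ := by
  rw [← div_eq_mul_inv, inv_eq_one_div, div_le_div_iff₀ (by positivity) (by positivity)]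
  have h1 : (y - x) ^ 2 ≤ 1 := (sq_le_one_iff_abs_le_one _).2 h
  nlinarith [sq_nonneg (2 * y - x)]

namespace IsMKdVJet

variable {U : ℕ → ℝ → ℝ → ℝ}

theorem continuous_slice (hU : IsMKdVJet U) (k : ℕ) (t : ℝ) : Continuous (U k t) :=
  continuous_iff_continuousAt.2 fun x => (hU.hasDerivAt_space k t x).continuousAt

theorem isClosed_sobolevSq_le (hU : IsMKdVJet U) (K : ℝ) :
    IsClosed {t | sobolevSq (U 0 t) (U 1 t) (U 2 t) ≤ K} := by
  set g : ℝ → ℝ → ℝ := fun t x => U 0 t x ^ 2 + U 1 t x ^ 2 + U 2 t x ^ 2 with hg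
  have hgc : Continuous (Function.uncurry g) :=
    (((hU.continuous 0).pow 2).add ((hU.continuous 1).pow 2)).add ((hU.continuous 2).pow 2)
  have hgi : ∀ t, Integrable (g t) := fun t =>
    (((hU.jet t).decay₀.pow two_ne_zero).integrable.add
      ((hU.jet t).decay₁.pow two_ne_zero).integrable).add
      ((hU.jet t).decay₂.pow two_ne_zero).integrable
  have hset : {t | sobolevSq (U 0 t) (U 1 t) (U 2 t) ≤ K}
      = ⋂ n : ℕ, {t | ∫ x in (-n : ℝ)..n, g t x ≤ K} := by
    ext t
    simp only [mem_ofPred_eq, mem_iInter]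
    constructor
    · intro h n
      rw [intervalIntegral.integral_of_le (by linarith [n.cast_nonneg (α := ℝ)])]
      exact (setIntegral_le_integral (hgi t) (ae_of_all _ fun x => by
        simp only [hg, Pi.zero_apply]; positivity)).trans h
    · intro h
      exact le_of_tendsto' (intervalIntegral_tendsto_integral (hgi t)
        (tendsto_neg_atTop_atBot.comp tendsto_natCast_atTop_atTop)
        tendsto_natCast_atTop_atTop) h
  rw [hset]
  exact isClosed_iInter fun n => isClosed_le
    (intervalIntegral.continuous_parametric_intervalIntegral_of_continuous' hgc _ _)
    continuous_const

/-- The mass is constant on time intervals where the `H²` norm is bounded. -/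
theorem mass_eq (hU : IsMKdVJet U) {a b K : ℝ} (hab : a ≤ b)
    (hK : ∀ t ∈ Icc a b, sobolevSq (U 0 t) (U 1 t) (U 2 t) ≤ K) :
    ∫ x, U 0 a x ^ 2 = ∫ x, U 0 b x ^ 2 := by
  obtain ⟨X, B, hB, hXd, hXs, hX1, hX0, hXk⟩ := exists_cutoff_sequence
  have hXc : ∀ n k, Continuous (X n k) := fun n k =>
    continuous_iff_continuousAt.2 fun x => (hXd n k x).continuousAt
  set I : ℕ → ℝ → ℝ → ℝ := fun n t x => U 0 t x ^ 2 * X n 3 x - 3 * U 1 t x ^ 2 * X n 1 x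
    + 3 / 2 * U 0 t x ^ 4 * X n 1 x with hI
  have hIc : ∀ n t, Continuous (I n t) := fun n t => by
    have := hU.continuous_slice 0 t; have := hU.continuous_slice 1 t
    have := hXc n 1; have := hXc n 3
    fun_prop
  have hIle : ∀ n, ∀ t ∈ Icc a b, ∀ x, |I n t x|
      ≤ B * (3 + 3 / 2 * K) * (((n : ℝ) + 1) ^ 3)⁻¹ * (U 0 t x ^ 2 + U 1 t x ^ 2) := by
    intro n t ht x
    have h1 := hXk n 1 (by simp) x
    have h3 := hXk n 3 (by simp) x
    have h0 := ((hU.jet t).sq_le_sobolevSq₀ x).trans (hK t ht)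
    set s := B * (((n : ℝ) + 1) ^ 3)⁻¹ with hs
    have hs0 : 0 ≤ s := (abs_nonneg _).trans h1
    have hK0 : 0 ≤ K := (sq_nonneg _).trans h0
    have e1 : |U 0 t x ^ 2 * X n 3 x| ≤ U 0 t x ^ 2 * s := by
      rw [abs_mul, abs_of_nonneg (sq_nonneg _)]; gcongr
    have e2 : |3 * U 1 t x ^ 2 * X n 1 x| ≤ 3 * U 1 t x ^ 2 * s := by
      rw [abs_mul, abs_of_nonneg (by positivity)]; gcongr
    have e3 : |3 / 2 * U 0 t x ^ 4 * X n 1 x| ≤ 3 / 2 * (K * U 0 t x ^ 2) * s := by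
      rw [abs_mul, abs_of_nonneg (by positivity)]
      have : U 0 t x ^ 4 ≤ K * U 0 t x ^ 2 := by nlinarith [sq_nonneg (U 0 t x)]
      gcongr
    have e4 := abs_add_le (U 0 t x ^ 2 * X n 3 x - 3 * U 1 t x ^ 2 * X n 1 x)
      (3 / 2 * U 0 t x ^ 4 * X n 1 x)
    have e5 := abs_sub (U 0 t x ^ 2 * X n 3 x) (3 * U 1 t x ^ 2 * X n 1 x)
    have e6 : B * (3 + 3 / 2 * K) * (((n : ℝ) + 1) ^ 3)⁻¹ * (U 0 t x ^ 2 + U 1 t x ^ 2)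
        = s * (3 + 3 / 2 * K) * (U 0 t x ^ 2 + U 1 t x ^ 2) := by rw [hs]; ring
    rw [e6]
    have e7 : 0 ≤ s * U 0 t x ^ 2 := by positivity
    have e8 : 0 ≤ s * K * U 1 t x ^ 2 := by positivity
    simp only [hI]
    nlinarith
  have hr0 : ∀ n : ℕ, (0 : ℝ) ≤ (((n : ℝ) + 1) ^ 3)⁻¹ := fun n => by positivity
  have hr1 : ∀ n : ℕ, (((n : ℝ) + 1) ^ 3)⁻¹ ≤ 1 := fun n =>
    inv_le_one_of_one_le₀ (one_le_pow₀ (by linarith [n.cast_nonneg (α := ℝ)]))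
  have hr : Tendsto (fun n : ℕ => (((n : ℝ) + 1) ^ 3)⁻¹) atTop (𝓝 0) := by
    have h2 : Tendsto (fun n : ℕ => (n : ℝ) + 1) atTop atTop :=
      tendsto_natCast_atTop_atTop.atTop_add tendsto_const_nhds
    exact tendsto_inv_atTop_zero.comp ((tendsto_pow_atTop three_ne_zero).comp h2)
  have hIint : ∀ n, ∀ t ∈ Icc a b, |∫ x, I n t x|
      ≤ B * (3 + 3 / 2 * K) * K * (((n : ℝ) + 1) ^ 3)⁻¹ := by
    intro n t ht
    have hj := hU.jet t
    have hS := hj.sobolevSq_eq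
    have h2 : 0 ≤ ∫ x, U 2 t x ^ 2 := integral_nonneg fun x => sq_nonneg _
    have hK0 : 0 ≤ K := ((sq_nonneg _).trans (hj.sq_le_sobolevSq₀ 0)).trans (hK t ht)
    have hg : Integrable fun x => U 0 t x ^ 2 + U 1 t x ^ 2 :=
      (hj.decay₀.pow two_ne_zero).integrable.add (hj.decay₁.pow two_ne_zero).integrable
    refine (norm_integral_le_of_norm_le (f := I n t) (hg.const_mul _)
      (ae_of_all _ fun x => hIle n t ht x)).trans ?_
    rw [integral_const_mul, integral_add (hj.decay₀.pow two_ne_zero).integrable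
      (hj.decay₁.pow two_ne_zero).integrable]
    calc _ ≤ B * (3 + 3 / 2 * K) * (((n : ℝ) + 1) ^ 3)⁻¹ * K := by
          gcongr
          linarith [hK t ht]
      _ = _ := by ring
  refine eq_of_tendsto_of_bounded_deriv (Q := fun n t => ∫ x, U 0 t x ^ 2 * X n 0 x)
    (Q' := fun n t => ∫ x, I n t x) (F := fun t => ∫ x, U 0 t x ^ 2)
    (C := B * (3 + 3 / 2 * K) * K) hab (fun n t => ?_) (fun t _ => ?_) (fun n t ht => ?_)
    (fun t ht => ?_)
  · set e' : ℝ → ℝ → ℝ := fun t x => 2 * U 0 t x * -(U 3 t x + 3 * U 0 t x ^ 2 * U 1 t x) with he'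
    have hec : Continuous (Function.uncurry e') := by
      have h0 := hU.continuous 0; have h1 := hU.continuous 1; have h3 := hU.continuous 3
      exact (h0.const_mul 2).mul (h3.add (((h0.pow 2).const_mul 3).mul h1)).neg
    have key := hasDerivAt_integral_mul_hasCompactSupport (e := fun t x => U 0 t x ^ 2) (e' := e')
      (fun t => (hU.continuous_slice 0 t).pow 2) hec
      (fun t x => ((hU.hasDerivAt_time₀ t x).pow 2).congr_deriv (by simp [he'])) (hXc n 0)
      (hXs n 0) t
    refine key.congr_deriv ?_
    have c0 := hU.continuous_slice 0 t; have c1 := hU.continuous_slice 1 t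
    have c2 := hU.continuous_slice 2 t; have c3 := hU.continuous_slice 3 t
    have d0 := hU.hasDerivAt_space 0 t; have d1 := hU.hasDerivAt_space 1 t
    have d2 := hU.hasDerivAt_space 2 t
    refine integral_eq_of_flux (χ₁ := X n 1) (χ₂ := X n 2) (χ₃ := X n 3)
      (x₀ := fun x => -2 * (U 0 t x * U 2 t x) + U 1 t x ^ 2 - 3 / 2 * U 0 t x ^ 4)
      (x₁ := fun x => 2 * (U 0 t x * U 1 t x)) (x₂ := fun x => -U 0 t x ^ 2)
      (y₀ := fun x => -2 * (U 0 t x * U 3 t x) - 6 * U 0 t x ^ 3 * U 1 t x)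
      (y₁ := fun x => 2 * (U 1 t x ^ 2 + U 0 t x * U 2 t x))
      (y₂ := fun x => -2 * (U 0 t x * U 1 t x))
      (hec.comp (Continuous.prodMk_right t)) (by fun_prop) (by fun_prop) (by fun_prop)
      (fun x => ?_) (fun x => ?_) (fun x => ?_) (hXd n 0) (hXd n 1) (hXd n 2) (hXc n 3)
      (hXs n 0) (hXs n 1) (hXs n 2) (hXs n 3) (fun x => ?_)
    · exact (((((d0 x).mul (d2 x)).const_mul (-2)).add ((d1 x).pow 2)).sub
        (((d0 x).pow 4).const_mul (3 / 2))).congr_deriv (by norm_num; ring)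
    · exact (((d0 x).mul (d1 x)).const_mul 2).congr_deriv (by ring)
    · exact ((d0 x).pow 2).neg.congr_deriv (by norm_num; ring)
    · simp only [hI, he']
      ring
  · have hj := hU.jet t
    refine tendsto_integral_of_dominated_convergence (fun x => U 0 t x ^ 2 * B)
      (fun n => (((hU.continuous_slice 0 t).pow 2).mul (hXc n 0)).aestronglyMeasurable)
      ((hj.decay₀.pow two_ne_zero).integrable.mul_const B) (fun n => ae_of_all _ fun x => ?_)
      (ae_of_all _ fun x => by simpa using (hX1 x).const_mul (U 0 t x ^ 2))
    rw [norm_mul, Real.norm_of_nonneg (sq_nonneg _)]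
    exact mul_le_mul_of_nonneg_left (hX0 n x) (sq_nonneg _)
  · have hK0 : 0 ≤ K := ((sq_nonneg _).trans ((hU.jet t).sq_le_sobolevSq₀ 0)).trans (hK t ht)
    exact (hIint n t ht).trans (mul_le_of_le_one_right (by positivity) (hr1 n))
  · refine squeeze_zero_norm (fun n => hIint n t ht) ?_
    simpa using hr.const_mul (B * (3 + 3 / 2 * K) * K)

end IsMKdVJet

/-- The source in the balance law for the cut-off discretized second energy. -/
noncomputable def energyFlux (u₀ u₁ u₂ v₀ v₁ v₂ w₀ w₁ z c₀ c₁ c₂ c₃ : ℝ) : ℝ :=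
  -(3 / 2) * (w₁ * w₁ * ((2 * (u₀ * u₁) + u₁ * v₀ + u₀ * v₁ + 2 * (v₀ * v₁)) * c₀))
    - w₁ * (2 * (u₁ * u₁) + 2 * (u₀ * u₂) + v₀ * u₂ + 2 * (u₁ * v₁) + u₀ * v₂ + 2 * (v₁ * v₁)
      + 2 * (v₀ * v₂)) * (w₀ * c₀)
    + 1 / 2 * (w₁ * w₁ * ((u₀ * u₀ + u₀ * v₀ + v₀ * v₀) * c₁)) - 3 / 2 * z
    + 1 / 2 * (w₁ * w₁ * c₃) + 15 * (u₂ * u₂ * (u₀ * u₁ * c₀)) + 6 * (u₁ * u₂ * (u₁ * u₁ * c₀))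
    + 15 * (u₁ * u₂ * (u₀ * u₁ * c₁)) + 15 / 2 * (u₂ * u₂ * (u₀ * u₀ * c₁))
    + 3 / 2 * (u₀ * u₂ * (u₀ * u₀ * (u₀ * u₀) * c₁))
    - 45 / 4 * (u₁ * u₁ * (u₀ * u₀ * (u₀ * u₀) * c₁)) + 1 / 4 * (u₁ * u₁ * (u₁ * u₁ * c₁))
    + 9 / 16 * (u₀ * u₀ * (u₀ * u₀ * (u₀ * u₀) * (u₀ * u₀) * c₁))
    + 5 * (u₁ * u₂ * (u₀ * u₀ * c₂))

theorem abs_energyFlux_le {u₀ u₁ u₂ v₀ v₁ v₂ w₀ w₁ z c₀ c₁ c₂ c₃ m g B : ℝ}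
    (hu₀ : |u₀| ≤ m) (hu₁ : |u₁| ≤ m) (hv₀ : |v₀| ≤ m) (hv₁ : |v₁| ≤ m) (hw₀ : |w₀| ≤ m)
    (gu₀ : |u₀| ≤ g) (gu₁ : |u₁| ≤ g) (gu₂ : |u₂| ≤ g) (gv₁ : |v₁| ≤ g) (gv₂ : |v₂| ≤ g)
    (gw₁ : |w₁| ≤ g) (hz : |z| ≤ 4 * B * g ^ 2)
    (hc₀ : |c₀| ≤ B) (hc₁ : |c₁| ≤ B) (hc₂ : |c₂| ≤ B) (hc₃ : |c₃| ≤ B) :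
    |energyFlux u₀ u₁ u₂ v₀ v₁ v₂ w₀ w₁ z c₀ c₁ c₂ c₃|
      ≤ B * (7 + 80 * m ^ 2 + 13 * m ^ 4 + m ^ 6) * g ^ 2 := by
  have hB : 0 ≤ B := (abs_nonneg _).trans hc₀
  have hm : 0 ≤ m := (abs_nonneg _).trans hu₀
  have hg : 0 ≤ g := (abs_nonneg _).trans gu₀
  have P : ∀ {a b A C : ℝ}, |a| ≤ A → |b| ≤ C → |a * b| ≤ A * C := fun ha hb => by
    rw [abs_mul]
    exact mul_le_mul ha hb (abs_nonneg _) ((abs_nonneg _).trans ha)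
  have t₁ := P (P gw₁ gw₁) (P (show |2 * (u₀ * u₁) + u₁ * v₀ + u₀ * v₁ + 2 * (v₀ * v₁)|
      ≤ 6 * (m * m) by
    have h1 := abs_le.1 (P hu₀ hu₁); have h2 := abs_le.1 (P hu₁ hv₀)
    have h3 := abs_le.1 (P hu₀ hv₁); have h4 := abs_le.1 (P hv₀ hv₁)
    rw [abs_le]; constructor <;> linarith) hc₀)
  have t₂ := P (P gw₁ (show |2 * (u₁ * u₁) + 2 * (u₀ * u₂) + v₀ * u₂ + 2 * (u₁ * v₁) + u₀ * v₂
      + 2 * (v₁ * v₁) + 2 * (v₀ * v₂)| ≤ 12 * (m * g) by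
    have h1 := abs_le.1 (P hu₁ gu₁); have h2 := abs_le.1 (P hu₀ gu₂)
    have h3 := abs_le.1 (P hv₀ gu₂); have h4 := abs_le.1 (P hu₁ gv₁)
    have h5 := abs_le.1 (P hu₀ gv₂); have h6 := abs_le.1 (P hv₁ gv₁)
    have h7 := abs_le.1 (P hv₀ gv₂)
    rw [abs_le]; constructor <;> linarith)) (P hw₀ hc₀)
  have t₃ := P (P gw₁ gw₁) (P (show |u₀ * u₀ + u₀ * v₀ + v₀ * v₀| ≤ 3 * (m * m) by
    have h1 := abs_le.1 (P hu₀ hu₀); have h2 := abs_le.1 (P hu₀ hv₀)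
    have h3 := abs_le.1 (P hv₀ hv₀)
    rw [abs_le]; constructor <;> linarith) hc₁)
  have t₄ := P (P gw₁ gw₁) hc₃
  have t₅ := P (P gu₂ gu₂) (P (P hu₀ hu₁) hc₀)
  have t₆ := P (P gu₁ gu₂) (P (P hu₁ hu₁) hc₀)
  have t₇ := P (P gu₁ gu₂) (P (P hu₀ hu₁) hc₁)
  have t₈ := P (P gu₂ gu₂) (P (P hu₀ hu₀) hc₁)
  have t₉ := P (P gu₀ gu₂) (P (P (P hu₀ hu₀) (P hu₀ hu₀)) hc₁)
  have t₁₀ := P (P gu₁ gu₁) (P (P (P hu₀ hu₀) (P hu₀ hu₀)) hc₁)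
  have t₁₁ := P (P gu₁ gu₁) (P (P hu₁ hu₁) hc₁)
  have t₁₂ := P (P gu₀ gu₀) (P (P (P (P hu₀ hu₀) (P hu₀ hu₀)) (P hu₀ hu₀)) hc₁)
  have t₁₃ := P (P gu₁ gu₂) (P (P hu₀ hu₀) hc₂)
  have p₀ : 0 ≤ B * g ^ 2 := by positivity
  have p₂ : 0 ≤ B * m ^ 2 * g ^ 2 := by positivity
  have p₄ : 0 ≤ B * m ^ 4 * g ^ 2 := by positivity
  have p₆ : 0 ≤ B * m ^ 6 * g ^ 2 := by positivity
  rw [abs_le] at t₁ t₂ t₃ t₄ t₅ t₆ t₇ t₈ t₉ t₁₀ t₁₁ t₁₂ t₁₃ hz ⊢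
  rw [energyFlux]
  constructor <;> linarith

/-- The balance law for the cut-off discretized second energy. -/
theorem integral_energyRate_eq {a b w χ : ℕ → ℝ → ℝ} {κ : ℝ}
    (ha : ∀ k x, HasDerivAt (a k) (a (k + 1) x) x) (hb : ∀ k x, HasDerivAt (b k) (b (k + 1) x) x)
    (hw : ∀ k x, w k x = κ * (b k x - a k x))
    (hχ : ∀ k x, HasDerivAt (χ k) (χ (k + 1) x) x) (hχs : ∀ k, HasCompactSupport (χ k)) :
    ∫ x, (w 1 x * (κ * (-(b 4 x + 3 * b 0 x ^ 2 * b 2 x + 6 * b 0 x * b 1 x ^ 2)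
          - -(a 4 x + 3 * a 0 x ^ 2 * a 2 x + 6 * a 0 x * a 1 x ^ 2)))
        + ((-5 * (a 0 x * a 1 x ^ 2) + 3 / 2 * a 0 x ^ 5) * -(a 3 x + 3 * a 0 x ^ 2 * a 1 x)
        - 5 * (a 0 x ^ 2 * a 1 x)
          * -(a 4 x + 3 * a 0 x ^ 2 * a 2 x + 6 * a 0 x * a 1 x ^ 2))) * χ 0 x
      = ∫ x, energyFlux (a 0 x) (a 1 x) (a 2 x) (b 0 x) (b 1 x) (b 2 x) (w 0 x) (w 1 x)
          (w 2 x ^ 2 * χ 1 x) (χ 0 x) (χ 1 x) (χ 2 x) (χ 3 x) := by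
  have hdw : ∀ k x, HasDerivAt (w k) (w (k + 1) x) x := fun k x => by
    rw [show w k = fun x => κ * (b k x - a k x) from funext (hw k), hw]
    exact ((hb k x).sub (ha k x)).const_mul κ
  have cont : ∀ {f : ℕ → ℝ → ℝ}, (∀ k x, HasDerivAt (f k) (f (k + 1) x) x) →
      ∀ k, Continuous (f k) := fun hf k =>
    continuous_iff_continuousAt.2 fun x => (hf k x).continuousAt
  have a0 := cont ha 0; have a1 := cont ha 1; have a2 := cont ha 2
  have a3 := cont ha 3; have a4 := cont ha 4
  have b0 := cont hb 0; have b1 := cont hb 1; have b2 := cont hb 2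
  have b4 := cont hb 4
  have w1 := cont hdw 1; have w2 := cont hdw 2; have w3 := cont hdw 3; have w4 := cont hdw 4
  refine integral_eq_of_flux (χ₁ := χ 1) (χ₂ := χ 2) (χ₃ := χ 3)
    (x₀ := fun x => -(w 1 x * w 3 x) + 1 / 2 * w 2 x ^ 2
      - 1 / 2 * (w 1 x ^ 2 * (a 0 x ^ 2 + a 0 x * b 0 x + b 0 x ^ 2))
      + 5 * (a 0 x ^ 2 * a 1 x * a 3 x) - 5 * (a 0 x * a 1 x ^ 2 * a 2 x)
      - 5 / 2 * (a 0 x ^ 2 * a 2 x ^ 2) - 3 / 2 * (a 0 x ^ 5 * a 2 x) - 1 / 4 * a 1 x ^ 4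
      + 45 / 4 * (a 0 x ^ 4 * a 1 x ^ 2) - 9 / 16 * a 0 x ^ 8)
    (x₁ := fun x => w 1 x * w 2 x - 5 * (a 0 x ^ 2 * a 1 x * a 2 x))
    (x₂ := fun x => -(1 / 2) * w 1 x ^ 2)
    (y₀ := fun x => -(w 1 x * w 4 x) - w 1 x * w 2 x * (a 0 x ^ 2 + a 0 x * b 0 x + b 0 x ^ 2)
      - 1 / 2 * w 1 x ^ 2
        * (2 * a 0 x * a 1 x + a 1 x * b 0 x + a 0 x * b 1 x + 2 * b 0 x * b 1 x)
      + 5 * a 0 x * a 1 x ^ 2 * a 3 x + 5 * a 0 x ^ 2 * a 1 x * a 4 x - 6 * a 1 x ^ 3 * a 2 x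
      - 15 * a 0 x * a 1 x * a 2 x ^ 2 + 15 * a 0 x ^ 4 * a 1 x * a 2 x
      - 3 / 2 * a 0 x ^ 5 * a 3 x + 45 * a 0 x ^ 3 * a 1 x ^ 3 - 9 / 2 * a 0 x ^ 7 * a 1 x)
    (y₁ := fun x => w 2 x ^ 2 + w 1 x * w 3 x - 10 * a 0 x * a 1 x ^ 2 * a 2 x
      - 5 * a 0 x ^ 2 * a 2 x ^ 2 - 5 * a 0 x ^ 2 * a 1 x * a 3 x)
    (y₂ := fun x => -(w 1 x * w 2 x))
    (by fun_prop) (by fun_prop) (by fun_prop) (by fun_prop)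
    (fun x => ?_) (fun x => ?_) (fun x => ?_) (hχ 0) (hχ 1) (hχ 2) (cont hχ 3)
    (hχs 0) (hχs 1) (hχs 2) (hχs 3) (fun x => ?_)
  · have q := ((ha 0 x).pow 2).add (((ha 0 x).mul (hb 0 x)).add ((hb 0 x).pow 2))
    have h := ((hdw 1 x).mul (hdw 3 x)).neg.add (((hdw 2 x).pow 2).const_mul (1 / 2))
      |>.sub ((((hdw 1 x).pow 2).mul q).const_mul (1 / 2))
      |>.add (((((ha 0 x).pow 2).mul (ha 1 x)).mul (ha 3 x)).const_mul 5)
      |>.sub ((((ha 0 x).mul ((ha 1 x).pow 2)).mul (ha 2 x)).const_mul 5)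
      |>.sub ((((ha 0 x).pow 2).mul ((ha 2 x).pow 2)).const_mul (5 / 2))
      |>.sub ((((ha 0 x).pow 5).mul (ha 2 x)).const_mul (3 / 2))
      |>.sub (((ha 1 x).pow 4).const_mul (1 / 4))
      |>.add ((((ha 0 x).pow 4).mul ((ha 1 x).pow 2)).const_mul (45 / 4))
      |>.sub (((ha 0 x).pow 8).const_mul (9 / 16))
    refine HasDerivAt.congr_deriv (f := _) (h.congr_of_eventuallyEq
      (Eventually.of_forall fun y => ?_)) ?_
    · simp only [Pi.add_apply, Pi.sub_apply, Pi.mul_apply, Pi.neg_apply, Pi.pow_apply]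
      ring
    · simp only [Pi.add_apply, Pi.mul_apply, Pi.pow_apply]
      norm_num
      ring
  · exact (((hdw 1 x).mul (hdw 2 x)).sub
      (((((ha 0 x).pow 2).mul (ha 1 x)).mul (ha 2 x)).const_mul 5)).congr_deriv (by
        simp only [Pi.mul_apply, Pi.pow_apply]
        norm_num
        ring)
  · exact (((hdw 1 x).pow 2).const_mul (-(1 / 2))).congr_deriv (by norm_num; ring)
  · simp only [energyFlux, hw]
    ring

/-- The forward difference quotient with step `(n + 1)⁻¹`. -/
noncomputable def differenceQuotient (f : ℝ → ℝ) (n : ℕ) (x : ℝ) : ℝ :=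
  ((n : ℝ) + 1) * (f (x + ((n : ℝ) + 1)⁻¹) - f x)

theorem abs_add_inv_sub_le (n : ℕ) (x : ℝ) : |x + ((n : ℝ) + 1)⁻¹ - x| ≤ 1 := by
  rw [add_sub_cancel_left, abs_of_nonneg (by positivity)]
  exact inv_le_one_of_one_le₀ (by linarith [n.cast_nonneg (α := ℝ)])

theorem tendsto_add_inv (x : ℝ) : Tendsto (fun n : ℕ => x + ((n : ℝ) + 1)⁻¹) atTop (𝓝 x) := by
  simpa [one_div] using (tendsto_one_div_add_atTop_nhds_zero_nat (𝕜 := ℝ)).const_add x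

theorem abs_differenceQuotient_le {f f' : ℝ → ℝ} (hf : ∀ x, HasDerivAt f (f' x) x) {D x : ℝ}
    (hD : ∀ y, |y - x| ≤ 1 → |f' y| ≤ D) (n : ℕ) : |differenceQuotient f n x| ≤ D := by
  have hh : (0 : ℝ) < ((n : ℝ) + 1)⁻¹ := by positivity
  obtain ⟨c, hc, he⟩ := exists_hasDerivAt_eq_slope f f' (show x < x + ((n : ℝ) + 1)⁻¹ by linarith)
    (fun y _ => (hf y).continuousAt.continuousWithinAt) (fun y _ => hf y)
  have h1 := abs_add_inv_sub_le n x
  have : differenceQuotient f n x = f' c := by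
    rw [he, differenceQuotient, add_sub_cancel_left, div_inv_eq_mul, mul_comm]
  rw [this]
  refine hD c ?_
  rw [abs_of_nonneg (by linarith)] at h1
  rw [abs_of_nonneg (by linarith [hc.1])]
  linarith [hc.2]

theorem tendsto_differenceQuotient {f : ℝ → ℝ} {d x : ℝ} (hf : HasDerivAt f d x) :
    Tendsto (fun n => differenceQuotient f n x) atTop (𝓝 d) := by
  have h : Tendsto (fun n : ℕ => ((n : ℝ) + 1)⁻¹) atTop (𝓝[≠] 0) :=
    tendsto_nhdsWithin_iff.2 ⟨by simpa using tendsto_add_inv 0,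
      Eventually.of_forall fun n => by
        have : (0 : ℝ) < ((n : ℝ) + 1)⁻¹ := by positivity
        exact this.ne'⟩
  refine ((hasDerivAt_iff_tendsto_slope_zero.1 hf).comp h).congr fun n => ?_
  simp [differenceQuotient]

theorem continuous_differenceQuotient {f : ℝ → ℝ} (hf : Continuous f) (n : ℕ) :
    Continuous (differenceQuotient f n) := by
  unfold differenceQuotient
  fun_prop

/-- `energyFlux` evaluated on a jet, its difference quotients, and a cutoff. -/
noncomputable def discreteFlux (a₀ a₁ a₂ : ℝ → ℝ) (χ : ℕ → ℝ → ℝ) (n : ℕ) (x : ℝ) : ℝ :=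
  energyFlux (a₀ x) (a₁ x) (a₂ x) (a₀ (x + ((n : ℝ) + 1)⁻¹)) (a₁ (x + ((n : ℝ) + 1)⁻¹))
    (a₂ (x + ((n : ℝ) + 1)⁻¹)) (differenceQuotient a₀ n x) (differenceQuotient a₁ n x)
    (differenceQuotient a₂ n x ^ 2 * χ 1 x) (χ 0 x) (χ 1 x) (χ 2 x) (χ 3 x)

/-- The quadratic density that controls `discreteFlux`. -/
noncomputable def fluxMajorant (a₀ a₁ a₂ : ℝ → ℝ) (n : ℕ) (x : ℝ) : ℝ :=
  (a₀ x ^ 2 + a₁ x ^ 2 + a₂ x ^ 2)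
    + (a₁ (x + ((n : ℝ) + 1)⁻¹) ^ 2 + a₂ (x + ((n : ℝ) + 1)⁻¹) ^ 2
      + differenceQuotient a₁ n x ^ 2)

namespace IsDecayingJet

variable {a₀ a₁ a₂ : ℝ → ℝ}

theorem continuous_discreteFlux (hj : IsDecayingJet a₀ a₁ a₂) {χ : ℕ → ℝ → ℝ}
    (hχ : ∀ k, Continuous (χ k)) (n : ℕ) : Continuous (discreteFlux a₀ a₁ a₂ χ n) := by
  have h0 := hj.decay₀.continuous; have h1 := hj.decay₁.continuous
  have h2 := hj.decay₂.continuous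
  have k0 := continuous_differenceQuotient h0 n; have k1 := continuous_differenceQuotient h1 n
  have k2 := continuous_differenceQuotient h2 n
  have c0 := hχ 0; have c1 := hχ 1; have c2 := hχ 2; have c3 := hχ 3
  unfold discreteFlux energyFlux
  fun_prop

theorem abs_discreteFlux_le (hj : IsDecayingJet a₀ a₁ a₂) {K B : ℝ}
    (hK : sobolevSq a₀ a₁ a₂ ≤ K) {χ : ℕ → ℝ → ℝ} {n : ℕ} (hχ₀ : ∀ x, |χ 0 x| ≤ B)
    (hχ : ∀ k ∈ Icc 1 3, ∀ x, |χ k x| ≤ B * (((n : ℝ) + 1) ^ 3)⁻¹) (x : ℝ) :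
    |discreteFlux a₀ a₁ a₂ χ n x|
      ≤ B * (7 + 80 * K + 13 * K ^ 2 + K ^ 3) * fluxMajorant a₀ a₁ a₂ n x := by
  have hB : 0 ≤ B := (abs_nonneg _).trans (hχ₀ 0)
  have hK0 : 0 ≤ K := ((sq_nonneg _).trans (hj.sq_le_sobolevSq₀ 0)).trans hK
  have hm0 : ∀ y, |a₀ y| ≤ √K := fun y => abs_le_sqrt ((hj.sq_le_sobolevSq₀ y).trans hK)
  have hm1 : ∀ y, |a₁ y| ≤ √K := fun y => abs_le_sqrt ((hj.sq_le_sobolevSq₁ y).trans hK)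
  have hG : ∀ s : ℝ, s ^ 2 ≤ fluxMajorant a₀ a₁ a₂ n x →
      |s| ≤ √(fluxMajorant a₀ a₁ a₂ n x) := fun s => abs_le_sqrt
  have hG0 : 0 ≤ fluxMajorant a₀ a₁ a₂ n x := by unfold fluxMajorant; positivity
  have hn1 : (1 : ℝ) ≤ (n : ℝ) + 1 := by linarith [n.cast_nonneg (α := ℝ)]
  have hr1 : (((n : ℝ) + 1) ^ 3)⁻¹ ≤ 1 := inv_le_one_of_one_le₀ (one_le_pow₀ hn1)
  have hχ' : ∀ k ∈ Icc 1 3, |χ k x| ≤ B := fun k hk =>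
    (hχ k hk x).trans (mul_le_of_le_one_right hB hr1)
  have hz : |differenceQuotient a₂ n x ^ 2 * χ 1 x|
      ≤ 4 * B * √(fluxMajorant a₀ a₁ a₂ n x) ^ 2 := by
    rw [sq_sqrt hG0, abs_mul, abs_of_nonneg (sq_nonneg _)]
    calc _ ≤ differenceQuotient a₂ n x ^ 2 * (B * (((n : ℝ) + 1) ^ 3)⁻¹) := by
          gcongr
          exact hχ 1 (by simp) x
      _ = B * ((n : ℝ) + 1)⁻¹ * (a₂ (x + ((n : ℝ) + 1)⁻¹) - a₂ x) ^ 2 := by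
          rw [differenceQuotient]
          field_simp
      _ ≤ B * 1 * (2 * (a₂ (x + ((n : ℝ) + 1)⁻¹) ^ 2 + a₂ x ^ 2)) := by
          gcongr
          · exact inv_le_one_of_one_le₀ hn1
          · nlinarith [sq_nonneg (a₂ (x + ((n : ℝ) + 1)⁻¹) + a₂ x)]
      _ ≤ _ := by
          have : a₂ (x + ((n : ℝ) + 1)⁻¹) ^ 2 + a₂ x ^ 2 ≤ fluxMajorant a₀ a₁ a₂ n x := by
            unfold fluxMajorant
            linarith [sq_nonneg (a₀ x), sq_nonneg (a₁ x),
              sq_nonneg (a₁ (x + ((n : ℝ) + 1)⁻¹)), sq_nonneg (differenceQuotient a₁ n x)]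
          nlinarith [mul_le_mul_of_nonneg_left this hB, mul_nonneg hB hG0]
  have key := abs_energyFlux_le (hm0 x) (hm1 x) (hm0 (x + ((n : ℝ) + 1)⁻¹))
    (hm1 (x + ((n : ℝ) + 1)⁻¹)) (abs_differenceQuotient_le (x := x) hj.hasDerivAt₀ (fun y _ => hm1 y) n)
    (hG (a₀ x) ?_) (hG (a₁ x) ?_) (hG (a₂ x) ?_) (hG (a₁ (x + ((n : ℝ) + 1)⁻¹)) ?_)
    (hG (a₂ (x + ((n : ℝ) + 1)⁻¹)) ?_) (hG (differenceQuotient a₁ n x) ?_) hz (hχ₀ x)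
    (hχ' 1 (by simp)) (hχ' 2 (by simp)) (hχ' 3 (by simp))
  · rwa [sq_sqrt hG0, show √K ^ 4 = (√K ^ 2) ^ 2 by ring, show √K ^ 6 = (√K ^ 2) ^ 3 by ring,
      sq_sqrt hK0] at key
  all_goals
    unfold fluxMajorant
    linarith [sq_nonneg (a₀ x), sq_nonneg (a₁ x), sq_nonneg (a₂ x),
      sq_nonneg (a₁ (x + ((n : ℝ) + 1)⁻¹)), sq_nonneg (a₂ (x + ((n : ℝ) + 1)⁻¹)),
      sq_nonneg (differenceQuotient a₁ n x)]

theorem exists_fluxMajorant_le (hj : IsDecayingJet a₀ a₁ a₂) :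
    ∃ C, ∀ n x, fluxMajorant a₀ a₁ a₂ n x ≤ C * (1 + x ^ 2)⁻¹ := by
  obtain ⟨C₀, h₀⟩ := hj.decay₀.bound
  obtain ⟨C₁, h₁⟩ := hj.decay₁.bound
  obtain ⟨C₂, h₂⟩ := hj.decay₂.bound
  have hsq : ∀ {s C x : ℝ}, |s| ≤ C * (1 + x ^ 2)⁻¹ → s ^ 2 ≤ C ^ 2 * (1 + x ^ 2)⁻¹ := by
    intro s C x hs
    have hw : (1 + x ^ 2)⁻¹ ≤ (1 : ℝ) := inv_le_one_of_one_le₀ (by nlinarith [sq_nonneg x])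
    have hw0 : (0 : ℝ) < (1 + x ^ 2)⁻¹ := by positivity
    calc s ^ 2 = |s| ^ 2 := (sq_abs s).symm
      _ ≤ (C * (1 + x ^ 2)⁻¹) ^ 2 := by gcongr
      _ = C ^ 2 * ((1 + x ^ 2)⁻¹ * (1 + x ^ 2)⁻¹) := by ring
      _ ≤ C ^ 2 * ((1 + x ^ 2)⁻¹ * 1) := by gcongr
      _ = _ := by ring
  have hsh : ∀ {f : ℝ → ℝ} {C x y : ℝ}, (∀ x, |f x| ≤ C * (1 + x ^ 2)⁻¹) → |y - x| ≤ 1 →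
      |f y| ≤ 3 * C * (1 + x ^ 2)⁻¹ := by
    intro f C x y hf hy
    have hC : 0 ≤ C := nonneg_of_mul_nonneg_left ((abs_nonneg _).trans (hf 0)) (by positivity)
    calc |f y| ≤ C * (1 + y ^ 2)⁻¹ := hf y
      _ ≤ C * (3 * (1 + x ^ 2)⁻¹) := by gcongr; exact one_add_sq_inv_le hy
      _ = _ := by ring
  refine ⟨C₀ ^ 2 + C₁ ^ 2 + C₂ ^ 2 + ((3 * C₁) ^ 2 + (3 * C₂) ^ 2 + (3 * C₂) ^ 2), fun n x => ?_⟩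
  have e0 := hsq (h₀ x)
  have e1 := hsq (h₁ x)
  have e2 := hsq (h₂ x)
  have e3 := hsq (hsh h₁ (abs_add_inv_sub_le n x))
  have e4 := hsq (hsh h₂ (abs_add_inv_sub_le n x))
  have e5 := hsq (abs_differenceQuotient_le (x := x) hj.hasDerivAt₁ (fun y hy => hsh h₂ hy) n)
  unfold fluxMajorant
  linarith

theorem integral_fluxMajorant_le (hj : IsDecayingJet a₀ a₁ a₂) (n : ℕ) :
    Integrable (fluxMajorant a₀ a₁ a₂ n)
      ∧ ∫ x, fluxMajorant a₀ a₁ a₂ n x ≤ 3 * sobolevSq a₀ a₁ a₂ := by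
  have i0 := (hj.decay₀.pow two_ne_zero).integrable
  have i1 := (hj.decay₁.pow two_ne_zero).integrable
  have i2 := (hj.decay₂.pow two_ne_zero).integrable
  have i3 := i1.comp_add_right ((n : ℝ) + 1)⁻¹
  have i4 := i2.comp_add_right ((n : ℝ) + 1)⁻¹
  have hc1 := hj.decay₁.continuous
  have hq := continuous_differenceQuotient hc1 n
  have i5 : Integrable fun x => differenceQuotient a₁ n x ^ 2 := by
    refine (((i3.add i1).const_mul (2 * ((n : ℝ) + 1) ^ 2))).mono' (hq.pow 2).aestronglyMeasurable
      (ae_of_all _ fun x => ?_)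
    rw [norm_of_nonneg (sq_nonneg _), differenceQuotient, mul_pow, mul_comm 2, mul_assoc]
    simp only [Pi.add_apply]
    gcongr
    nlinarith [sq_nonneg (a₁ (x + ((n : ℝ) + 1)⁻¹) + a₁ x)]
  have i34 : Integrable fun x => a₁ (x + ((n : ℝ) + 1)⁻¹) ^ 2 + a₂ (x + ((n : ℝ) + 1)⁻¹) ^ 2 :=
    i3.add i4
  have hS := hj.sobolevSq_eq
  have h5 : ∫ x, differenceQuotient a₁ n x ^ 2 ≤ ∫ x, a₂ x ^ 2 :=
    integral_sq_differenceQuotient_le hj.hasDerivAt₁ hj.decay₂.continuous i2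
      (mul_inv_cancel₀ (by positivity))
  have e3 : ∫ x, a₁ (x + ((n : ℝ) + 1)⁻¹) ^ 2 = ∫ x, a₁ x ^ 2 :=
    integral_add_right_eq_self (fun x => a₁ x ^ 2) _
  have e4 : ∫ x, a₂ (x + ((n : ℝ) + 1)⁻¹) ^ 2 = ∫ x, a₂ x ^ 2 :=
    integral_add_right_eq_self (fun x => a₂ x ^ 2) _
  have p0 : 0 ≤ ∫ x, a₀ x ^ 2 := integral_nonneg fun x => sq_nonneg _
  have p1 : 0 ≤ ∫ x, a₁ x ^ 2 := integral_nonneg fun x => sq_nonneg _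
  have j : Integrable fun x => a₁ (x + ((n : ℝ) + 1)⁻¹) ^ 2 + a₂ (x + ((n : ℝ) + 1)⁻¹) ^ 2
      + differenceQuotient a₁ n x ^ 2 := i34.add i5
  have j0 : Integrable fun x => a₀ x ^ 2 + a₁ x ^ 2 + a₂ x ^ 2 := (i0.add i1).add i2
  refine ⟨j0.add j, ?_⟩
  unfold fluxMajorant
  rw [integral_add j0 j, integral_add i34 i5, integral_add i3 i4, e3, e4]
  change sobolevSq a₀ a₁ a₂ + _ ≤ _
  linarith

theorem abs_integral_discreteFlux_le (hj : IsDecayingJet a₀ a₁ a₂) {K B : ℝ}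
    (hK : sobolevSq a₀ a₁ a₂ ≤ K) {χ : ℕ → ℝ → ℝ} {n : ℕ} (hχ₀ : ∀ x, |χ 0 x| ≤ B)
    (hχ : ∀ k ∈ Icc 1 3, ∀ x, |χ k x| ≤ B * (((n : ℝ) + 1) ^ 3)⁻¹) :
    |∫ x, discreteFlux a₀ a₁ a₂ χ n x|
      ≤ B * (7 + 80 * K + 13 * K ^ 2 + K ^ 3) * (3 * K) := by
  have hB : 0 ≤ B := (abs_nonneg _).trans (hχ₀ 0)
  have hK0 : 0 ≤ K := ((sq_nonneg _).trans (hj.sq_le_sobolevSq₀ 0)).trans hK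
  obtain ⟨hi, hle⟩ := hj.integral_fluxMajorant_le n
  refine (norm_integral_le_of_norm_le (f := discreteFlux a₀ a₁ a₂ χ n) (hi.const_mul _)
    (ae_of_all _ (hj.abs_discreteFlux_le hK hχ₀ hχ))).trans ?_
  rw [integral_const_mul]
  gcongr
  linarith

theorem tendsto_integral_discreteFlux (hj : IsDecayingJet a₀ a₁ a₂) {X : ℕ → ℕ → ℝ → ℝ} {B : ℝ}
    (hXc : ∀ n k, Continuous (X n k)) (hX1 : ∀ x, Tendsto (fun n => X n 0 x) atTop (𝓝 1))
    (hX0 : ∀ n x, |X n 0 x| ≤ B)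
    (hXk : ∀ n, ∀ k ∈ Icc 1 3, ∀ x, |X n k x| ≤ B * (((n : ℝ) + 1) ^ 3)⁻¹) :
    Tendsto (fun n => ∫ x, discreteFlux a₀ a₁ a₂ (X n) n x) atTop (𝓝 0) := by
  have hB : 0 ≤ B := (abs_nonneg _).trans (hX0 0 0)
  have hK0 : 0 ≤ sobolevSq a₀ a₁ a₂ := (sq_nonneg _).trans (hj.sq_le_sobolevSq₀ 0)
  obtain ⟨C, hC⟩ := hj.exists_fluxMajorant_le
  refine tendsto_integral_zero_of_abs_le_inv_one_add_sq
    (fun n => hj.continuous_discreteFlux (hXc n) n) (fun n x =>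
    (hj.abs_discreteFlux_le le_rfl (hX0 n) (hXk n) x).trans
      ((mul_le_mul_of_nonneg_left (hC n x) (by positivity)).trans_eq (mul_assoc _ _ _).symm))
    fun x => ?_
  have hn : Tendsto (fun n : ℕ => ((n : ℝ) + 1)⁻¹) atTop (𝓝 0) := by
    simpa using tendsto_add_inv 0
  have hr : Tendsto (fun n : ℕ => B * (((n : ℝ) + 1) ^ 3)⁻¹) atTop (𝓝 0) := by
    simpa using (hn.pow 3).const_mul B
  have hXk0 : ∀ k ∈ Icc 1 3, Tendsto (fun n => X n k x) atTop (𝓝 0) := fun k hk =>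
    squeeze_zero_norm (fun n => hXk n k hk x) hr
  have v0 := (hj.decay₀.continuous.tendsto x).comp (tendsto_add_inv x)
  have v1 := (hj.decay₁.continuous.tendsto x).comp (tendsto_add_inv x)
  have v2 := (hj.decay₂.continuous.tendsto x).comp (tendsto_add_inv x)
  have w0 := tendsto_differenceQuotient (hj.hasDerivAt₀ x)
  have w1 := tendsto_differenceQuotient (hj.hasDerivAt₁ x)
  have z0 : Tendsto (fun n => differenceQuotient a₂ n x ^ 2 * X n 1 x) atTop (𝓝 0) := by
    refine squeeze_zero_norm (a := fun n : ℕ =>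
      B * ((n : ℝ) + 1)⁻¹ * (a₂ (x + ((n : ℝ) + 1)⁻¹) - a₂ x) ^ 2) (fun n => ?_) ?_
    · rw [norm_mul, norm_of_nonneg (sq_nonneg _)]
      calc _ ≤ differenceQuotient a₂ n x ^ 2 * (B * (((n : ℝ) + 1) ^ 3)⁻¹) := by
            gcongr
            exact hXk n 1 (by simp) x
        _ = _ := by
            rw [differenceQuotient]
            field_simp
    · simpa using (hn.const_mul B).mul ((v2.sub_const (a₂ x)).pow 2)
  have key : ContinuousAt (fun p : ℝ × ℝ × ℝ × ℝ × ℝ × ℝ × ℝ × ℝ × ℝ × ℝ =>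
      energyFlux (a₀ x) (a₁ x) (a₂ x) p.1 p.2.1 p.2.2.1 p.2.2.2.1 p.2.2.2.2.1 p.2.2.2.2.2.1
        p.2.2.2.2.2.2.1 p.2.2.2.2.2.2.2.1 p.2.2.2.2.2.2.2.2.1 p.2.2.2.2.2.2.2.2.2)
      (a₀ x, a₁ x, a₂ x, a₁ x, a₂ x, 0, 1, 0, 0, 0) := by
    unfold energyFlux
    fun_prop
  have := key.tendsto.comp (v0.prodMk_nhds (v1.prodMk_nhds (v2.prodMk_nhds (w0.prodMk_nhds
    (w1.prodMk_nhds (z0.prodMk_nhds ((hX1 x).prodMk_nhds ((hXk0 1 (by simp)).prodMk_nhds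
    ((hXk0 2 (by simp)).prodMk_nhds (hXk0 3 (by simp)))))))))))
  refine (this.congr fun n => rfl).trans_eq ?_
  congr 1
  simp only [energyFlux]
  ring

/-- The cut-off discretized energies converge to the energy. -/
theorem tendsto_discreteEnergy (hj : IsDecayingJet a₀ a₁ a₂) {χ : ℕ → ℝ → ℝ} {B : ℝ}
    (hχc : ∀ n, Continuous (χ n)) (hχ1 : ∀ x, Tendsto (fun n => χ n x) atTop (𝓝 1))
    (hχ0 : ∀ n x, |χ n x| ≤ B) :
    Tendsto (fun n => ∫ x, (1 / 2 * differenceQuotient a₁ n x ^ 2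
      + (-(5 / 2) * (a₀ x ^ 2 * a₁ x ^ 2) + 1 / 4 * a₀ x ^ 6)) * χ n x) atTop
      (𝓝 (mkdvEnergy a₀ a₁ a₂)) := by
  have hB : 0 ≤ B := (abs_nonneg _).trans (hχ0 0 0)
  obtain ⟨C, hC⟩ := hj.exists_fluxMajorant_le
  have d0 := hj.decay₀; have d1 := hj.decay₁; have d2 := hj.decay₂
  have i2 := (d2.pow two_ne_zero).integrable
  have i01 := ((d0.pow two_ne_zero).mul (d1.pow two_ne_zero)).integrable
  have i6 := (d0.pow (n := 6) (by norm_num)).integrable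
  have ir : Integrable fun x => -(5 / 2) * (a₀ x ^ 2 * a₁ x ^ 2) + 1 / 4 * a₀ x ^ 6 :=
    (i01.const_mul _).add (i6.const_mul _)
  have hE : mkdvEnergy a₀ a₁ a₂ = ∫ x, (1 / 2 * a₂ x ^ 2
      + (-(5 / 2) * (a₀ x ^ 2 * a₁ x ^ 2) + 1 / 4 * a₀ x ^ 6)) := by
    rw [integral_add (i2.const_mul _) ir, integral_add (i01.const_mul _) (i6.const_mul _),
      integral_const_mul, integral_const_mul, integral_const_mul, mkdvEnergy]
    ring
  rw [hE]
  have c0 := d0.continuous; have c1 := d1.continuous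
  refine tendsto_integral_of_dominated_convergence (fun x => (1 / 2 * (C * (1 + x ^ 2)⁻¹)
    + |-(5 / 2) * (a₀ x ^ 2 * a₁ x ^ 2) + 1 / 4 * a₀ x ^ 6|) * B) (fun n => ?_)
    ((((integrable_inv_one_add_sq.const_mul C).const_mul _).add ir.abs).mul_const B)
    (fun n => ae_of_all _ fun x => ?_) (ae_of_all _ fun x => ?_)
  · have := continuous_differenceQuotient c1 n
    have := hχc n
    exact Continuous.aestronglyMeasurable (by fun_prop)
  · rw [norm_mul]
    refine mul_le_mul ((norm_add_le _ _).trans (add_le_add ?_ le_rfl)) (hχ0 n x) (norm_nonneg _)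
      ?_
    · rw [norm_of_nonneg (by positivity)]
      gcongr
      refine le_trans ?_ (hC n x)
      unfold fluxMajorant
      linarith [sq_nonneg (a₀ x), sq_nonneg (a₁ x), sq_nonneg (a₂ x),
        sq_nonneg (a₁ (x + ((n : ℝ) + 1)⁻¹)), sq_nonneg (a₂ (x + ((n : ℝ) + 1)⁻¹))]
    · have : 0 ≤ C * (1 + x ^ 2)⁻¹ := le_trans (by unfold fluxMajorant; positivity) (hC 0 x)
      positivity
  · refine (((((tendsto_differenceQuotient (hj.hasDerivAt₁ x)).pow 2).const_mul
      (1 / 2)).add_const _).mul (hχ1 x)).trans_eq ?_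
    rw [mul_one]

end IsDecayingJet

namespace IsMKdVJet

variable {U : ℕ → ℝ → ℝ → ℝ}

/-- The energy is constant on time intervals where the `H²` norm is bounded. -/
theorem energy_eq (hU : IsMKdVJet U) {a b K : ℝ} (hab : a ≤ b)
    (hK : ∀ t ∈ Icc a b, sobolevSq (U 0 t) (U 1 t) (U 2 t) ≤ K) :
    mkdvEnergy (U 0 a) (U 1 a) (U 2 a) = mkdvEnergy (U 0 b) (U 1 b) (U 2 b) := by
  obtain ⟨X, B, hB, hXd, hXs, hX1, hX0, hXk⟩ := exists_cutoff_sequence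
  have hXc : ∀ n k, Continuous (X n k) := fun n k =>
    continuous_iff_continuousAt.2 fun x => (hXd n k x).continuousAt
  refine eq_of_tendsto_of_bounded_deriv
    (Q := fun n t => ∫ x, (1 / 2 * differenceQuotient (U 1 t) n x ^ 2
      + (-(5 / 2) * (U 0 t x ^ 2 * U 1 t x ^ 2) + 1 / 4 * U 0 t x ^ 6)) * X n 0 x)
    (Q' := fun n t => ∫ x, discreteFlux (U 0 t) (U 1 t) (U 2 t) (X n) n x)
    (F := fun t => mkdvEnergy (U 0 t) (U 1 t) (U 2 t)) hab (fun n t => ?_)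
    (fun t _ => (hU.jet t).tendsto_discreteEnergy (fun n => hXc n 0) hX1 hX0)
    (fun n t ht => (hU.jet t).abs_integral_discreteFlux_le (hK t ht) (hX0 n) (hXk n))
    (fun t _ => (hU.jet t).tendsto_integral_discreteFlux hXc hX1 hX0 hXk)
  have hrate := integral_energyRate_eq (a := fun k => U k t)
    (b := fun k x => U k t (x + ((n : ℝ) + 1)⁻¹)) (w := fun k => differenceQuotient (U k t) n)
    (χ := X n) (κ := (n : ℝ) + 1) (fun k x => hU.hasDerivAt_space k t x)
    (fun k x => (hU.hasDerivAt_space k t _).comp_add_const x _) (fun k x => rfl) (hXd n) (hXs n)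
  unfold discreteFlux
  rw [← hrate]
  have cs : ∀ k, Continuous fun p : ℝ × ℝ => U k p.1 (p.2 + ((n : ℝ) + 1)⁻¹) := fun k =>
    (hU.continuous k).comp (continuous_fst.prodMk (continuous_snd.add continuous_const))
  have cu : ∀ k, Continuous fun p : ℝ × ℝ => U k p.1 p.2 := hU.continuous
  have c0 := cu 0; have c1 := cu 1; have c2 := cu 2; have c3 := cu 3; have c4 := cu 4
  have s0 := cs 0; have s1 := cs 1; have s2 := cs 2; have s4 := cs 4
  refine hasDerivAt_integral_mul_hasCompactSupport
    (e := fun t x => 1 / 2 * differenceQuotient (U 1 t) n x ^ 2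
      + (-(5 / 2) * (U 0 t x ^ 2 * U 1 t x ^ 2) + 1 / 4 * U 0 t x ^ 6))
    (e' := fun t x => differenceQuotient (U 1 t) n x * (((n : ℝ) + 1) *
        (-(U 4 t (x + ((n : ℝ) + 1)⁻¹)
            + 3 * U 0 t (x + ((n : ℝ) + 1)⁻¹) ^ 2 * U 2 t (x + ((n : ℝ) + 1)⁻¹)
            + 6 * U 0 t (x + ((n : ℝ) + 1)⁻¹) * U 1 t (x + ((n : ℝ) + 1)⁻¹) ^ 2)
          - -(U 4 t x + 3 * U 0 t x ^ 2 * U 2 t x + 6 * U 0 t x * U 1 t x ^ 2)))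
        + ((-5 * (U 0 t x * U 1 t x ^ 2) + 3 / 2 * U 0 t x ^ 5)
            * -(U 3 t x + 3 * U 0 t x ^ 2 * U 1 t x)
          - 5 * (U 0 t x ^ 2 * U 1 t x)
            * -(U 4 t x + 3 * U 0 t x ^ 2 * U 2 t x + 6 * U 0 t x * U 1 t x ^ 2)))
    (fun t => ?_) ?_ (fun t x => ?_) (hXc n 0) (hXs n 0) t
  · have h0 := hU.continuous_slice 0 t; have h1 := hU.continuous_slice 1 t
    have := continuous_differenceQuotient h1 n
    fun_prop
  · unfold Function.uncurry differenceQuotient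
    fun_prop
  · have h0 := hU.hasDerivAt_time₀ t x
    have h1 := hU.hasDerivAt_time₁ t x
    have hw := ((hU.hasDerivAt_time₁ t (x + ((n : ℝ) + 1)⁻¹)).sub h1).const_mul ((n : ℝ) + 1)
    refine (((hw.pow 2).const_mul (1 / 2)).add
      ((((h0.pow 2).mul (h1.pow 2)).const_mul (-(5 / 2))).add
        ((h0.pow 6).const_mul (1 / 4)))).congr_deriv ?_
    simp only [differenceQuotient, Pi.sub_apply, Pi.pow_apply]
    norm_num
    ring

theorem energy_const (hU : IsMKdVJet U) (a b : ℝ) :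
    mkdvEnergy (U 0 a) (U 1 a) (U 2 a) = mkdvEnergy (U 0 b) (U 1 b) (U 2 b) := by
  have key := constant_of_closed_sublevel
    (S := fun t => sobolevSq (U 0 t) (U 1 t) (U 2 t))
    (E := fun t => (∫ x, U 0 t x ^ 2, mkdvEnergy (U 0 t) (U 1 t) (U 2 t)))
    hU.isClosed_sobolevSq_le
    (fun a b K hab hK => Prod.ext (hU.mass_eq hab hK) (hU.energy_eq hab hK))
    (fun M => ⟨_, fun s t hM hE => (hU.jet t).sobolevSq_le (M := max M (M / 2 + M ^ 3 / 4)) ?_ ?_⟩)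
    a b
  · exact congrArg Prod.snd key
  · have h1 : ∫ x, U 0 t x ^ 2 = ∫ x, U 0 s x ^ 2 := congrArg Prod.fst hE
    have hS := (hU.jet s).sobolevSq_eq
    have p1 : 0 ≤ ∫ x, U 1 s x ^ 2 := integral_nonneg fun x => sq_nonneg _
    have p2 : 0 ≤ ∫ x, U 2 s x ^ 2 := integral_nonneg fun x => sq_nonneg _
    rw [h1]
    exact le_trans (by linarith) (le_max_left _ _)
  · have h2 : mkdvEnergy (U 0 t) (U 1 t) (U 2 t) = mkdvEnergy (U 0 s) (U 1 s) (U 2 s) :=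
      congrArg Prod.snd hE
    rw [h2]
    exact ((hU.jet s).mkdvEnergy_le hM).trans (le_max_right _ _)

end IsMKdVJet

/-- The directional derivative of a function on the plane. -/
noncomputable def dirDeriv (v : ℝ × ℝ) (f : ℝ × ℝ → ℝ) (p : ℝ × ℝ) : ℝ := fderiv ℝ f p v

theorem ContDiff.dirDeriv {f : ℝ × ℝ → ℝ} (hf : ContDiff ℝ (⊤ : ℕ∞) f) (v : ℝ × ℝ) :
    ContDiff ℝ (⊤ : ℕ∞) (dirDeriv v f) :=
  (hf.fderiv_right (m := (⊤ : ℕ∞)) le_rfl).clm_apply contDiff_const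

theorem ContDiff.hasDerivAt_snd {f : ℝ × ℝ → ℝ} (hf : ContDiff ℝ (⊤ : ℕ∞) f) (t x : ℝ) :
    HasDerivAt (fun y => f (t, y)) (_root_.dirDeriv (0, 1) f (t, x)) x :=
  ((hf.differentiable (by simp)) (t, x)).hasFDerivAt.comp_hasDerivAt x
    ((hasDerivAt_const x t).prodMk (hasDerivAt_id x))

theorem ContDiff.hasDerivAt_fst {f : ℝ × ℝ → ℝ} (hf : ContDiff ℝ (⊤ : ℕ∞) f) (t x : ℝ) :
    HasDerivAt (fun s => f (s, x)) (_root_.dirDeriv (1, 0) f (t, x)) t :=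
  ((hf.differentiable (by simp)) (t, x)).hasFDerivAt.comp_hasDerivAt t
    ((hasDerivAt_id t).prodMk (hasDerivAt_const t x))

theorem dirDeriv_comm {f : ℝ × ℝ → ℝ} (hf : ContDiff ℝ (⊤ : ℕ∞) f) (v w : ℝ × ℝ) :
    dirDeriv v (dirDeriv w f) = dirDeriv w (dirDeriv v f) := by
  have hd : Differentiable ℝ (fderiv ℝ f) :=
    (hf.fderiv_right (m := (⊤ : ℕ∞)) le_rfl).differentiable (by simp)
  have key : ∀ v w p, dirDeriv v (dirDeriv w f) p = fderiv ℝ (fderiv ℝ f) p v w := by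
    intro v w p
    have h : HasFDerivAt (dirDeriv w f) ((fderiv ℝ (fderiv ℝ f) p).flip w) p :=
      ((hd p).hasFDerivAt.clm_apply (hasFDerivAt_const w p)).congr_fderiv (by ext <;> simp)
    rw [dirDeriv, h.fderiv]
    rfl
  ext p
  rw [key, key]
  exact hf.contDiffAt.isSymmSndFDerivAt (by simp; norm_cast) v w

theorem hasInvSqDecay_of_forall_pow {f : ℝ → ℝ} (hf : Continuous f)
    (hd : ∀ n : ℕ, ∃ C : ℝ, ∀ x : ℝ, |x| ^ n * |f x| ≤ C) : HasInvSqDecay f := by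
  obtain ⟨C, hC⟩ := hd 0
  obtain ⟨D, hD⟩ := hd 2
  refine ⟨hf, C + D, fun x => ?_⟩
  have h1 := hC x
  have h2 := hD x
  rw [sq_abs] at h2
  rw [← div_eq_mul_inv, le_div_iff₀ (by positivity)]
  linarith

/-- The iterated space derivatives of a smooth function of time and space. -/
noncomputable def spaceJet (u : ℝ → ℝ → ℝ) (k : ℕ) (t x : ℝ) : ℝ :=
  (dirDeriv (0, 1))^[k] (Function.uncurry u) (t, x)

section SpaceJet

variable {u : ℝ → ℝ → ℝ}

theorem contDiff_spaceJet (hu : ContDiff ℝ (⊤ : ℕ∞) (Function.uncurry u)) (k : ℕ) :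
    ContDiff ℝ (⊤ : ℕ∞) ((dirDeriv (0, 1))^[k] (Function.uncurry u)) := by
  induction k with
  | zero => exact hu
  | succ k ih =>
    rw [Function.iterate_succ_apply']
    exact ih.dirDeriv _

theorem hasDerivAt_spaceJet (hu : ContDiff ℝ (⊤ : ℕ∞) (Function.uncurry u)) (k : ℕ) (t x : ℝ) :
    HasDerivAt (spaceJet u k t) (spaceJet u (k + 1) t x) x := by
  unfold spaceJet
  rw [Function.iterate_succ_apply']
  exact (contDiff_spaceJet hu k).hasDerivAt_snd t x

theorem deriv_spaceJet (hu : ContDiff ℝ (⊤ : ℕ∞) (Function.uncurry u)) (k : ℕ) (t : ℝ) :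
    deriv (spaceJet u k t) = spaceJet u (k + 1) t :=
  funext fun x => (hasDerivAt_spaceJet hu k t x).deriv

theorem iteratedDeriv_eq_spaceJet (hu : ContDiff ℝ (⊤ : ℕ∞) (Function.uncurry u)) (k : ℕ)
    (t : ℝ) : iteratedDeriv k (u t) = spaceJet u k t := by
  induction k with
  | zero => exact iteratedDeriv_zero
  | succ k ih => rw [iteratedDeriv_succ, ih, deriv_spaceJet hu]

theorem isMKdVJet_spaceJet (hu : ContDiff ℝ (⊤ : ℕ∞) (Function.uncurry u))
    (hmkdv : ∀ t x : ℝ, deriv (fun s => u s x) t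
      + deriv (fun y => deriv (deriv (u t)) y + (u t y) ^ 3) x = 0)
    (hdecay : ∀ t : ℝ, ∀ k : ℕ, k ≤ 4 → ∀ n : ℕ,
      ∃ C : ℝ, ∀ x : ℝ, |x| ^ n * |iteratedDeriv k (u t) x| ≤ C) :
    IsMKdVJet (spaceJet u) := by
  have hs := hasDerivAt_spaceJet hu
  have hd : ∀ t, ∀ k ≤ 4, HasInvSqDecay (spaceJet u k t) := fun t k hk =>
    hasInvSqDecay_of_forall_pow
      (continuous_iff_continuousAt.2 fun x => (hs k t x).continuousAt)
      (by simpa only [iteratedDeriv_eq_spaceJet hu] using hdecay t k hk)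
  have ht : ∀ t x, dirDeriv (1, 0) (Function.uncurry u) (t, x)
      = -(spaceJet u 3 t x + 3 * spaceJet u 0 t x ^ 2 * spaceJet u 1 t x) := by
    intro t x
    have h1 := hmkdv t x
    have h2 : deriv (deriv (u t)) = spaceJet u 2 t := by
      rw [← deriv_spaceJet hu 1, ← deriv_spaceJet hu 0]
      rfl
    have h3 : HasDerivAt (fun y => deriv (deriv (u t)) y + (u t y) ^ 3)
        (spaceJet u 3 t x + 3 * spaceJet u 0 t x ^ 2 * spaceJet u 1 t x) x := by
      rw [h2]
      exact (hs 2 t x).add ((hs 0 t x).pow 3)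
    have h4 : deriv (fun s => u s x) t = _ := (hu.hasDerivAt_fst t x).deriv
    rw [h3.deriv, h4] at h1
    linarith
  refine ⟨hs, fun k => (contDiff_spaceJet hu k).continuous, fun t x => ?_, fun t x => ?_,
    fun t => ⟨hs 0 t, hs 1 t, hd t 0 (by norm_num), hd t 1 (by norm_num), hd t 2 (by norm_num)⟩⟩
  · exact (hu.hasDerivAt_fst t x).congr_deriv (ht t x)
  · refine ((hu.dirDeriv (0, 1)).hasDerivAt_fst t x).congr_deriv ?_
    rw [dirDeriv_comm hu]
    have h5 := (hu.dirDeriv (1, 0)).hasDerivAt_snd t x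
    simp only [ht] at h5
    refine h5.unique ((((hs 3 t x).add
      ((((hs 0 t x).pow 2).const_mul 3).mul (hs 1 t x))).neg).congr_deriv ?_)
    norm_num
    ring

end SpaceJet

end

/-- Conservation of the second conserved quantity
`F[u](t) = (1/2) ∫ u_xx² - (5/2) ∫ u² u_x² + (1/4) ∫ u⁶`
for a smooth classical solution `u` of mKdV (`u_t + (u_xx + u³)_x = 0`) which is Schwartz
in `x` (together with its `x`-derivatives up to order four) at each time:
`F[u](t₁) = F[u](t₂)` for all times `t₁, t₂`. -/
theorem F_conserved
    (u : ℝ → ℝ → ℝ) (hu : ContDiff ℝ (⊤ : ℕ∞) (Function.uncurry u))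
    (hmkdv : ∀ t x : ℝ,
      deriv (fun s => u s x) t
        + deriv (fun y => deriv (deriv (u t)) y + (u t y) ^ 3) x = 0)
    (hdecay : ∀ t : ℝ, ∀ k : ℕ, k ≤ 4 → ∀ n : ℕ,
      ∃ C : ℝ, ∀ x : ℝ, |x| ^ n * |iteratedDeriv k (u t) x| ≤ C) :
    ∀ t₁ t₂ : ℝ,
      (1 / 2) * (∫ x : ℝ, (deriv (deriv (u t₁)) x) ^ 2)
        - (5 / 2) * (∫ x : ℝ, (u t₁ x) ^ 2 * (deriv (u t₁) x) ^ 2)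
        + (1 / 4) * (∫ x : ℝ, (u t₁ x) ^ 6)
      = (1 / 2) * (∫ x : ℝ, (deriv (deriv (u t₂)) x) ^ 2)
        - (5 / 2) * (∫ x : ℝ, (u t₂ x) ^ 2 * (deriv (u t₂) x) ^ 2)
        + (1 / 4) * (∫ x : ℝ, (u t₂ x) ^ 6) := by
  intro t₁ t₂
  have h := (isMKdVJet_spaceJet hu hmkdv hdecay).energy_const t₁ t₂
  have h1 : ∀ t, spaceJet u 1 t = deriv (u t) := fun t => (deriv_spaceJet hu 0 t).symm
  have h2 : ∀ t, spaceJet u 2 t = deriv (deriv (u t)) := fun t => by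
    rw [← h1, deriv_spaceJet hu]
  rwa [h1, h1, h2, h2] at h
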